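/- Let X be an integral non-degenerate n-dimensional variety in P^r that is not a cone, with S_{k-1}(X) ≠ P^r, and suppose dim G_{h,k}(X) = (k-h)(h+1) + n(k+1) - x with x > 0. Then dim S_k(X) ≤ n(k+1) + k - x - 2h. -/

import Mathlib

open Submodule

noncomputable section

/-- Polynomial functions on a complex module: the subalgebra of functions generated by
the linear functionals. -/
def PolyFun (W : Type*) [AddCommGroup W] [Module ℂ W] : Subalgebra ℂ (W → ℂ) :=
  Algebra.adjoin ℂ {f : W → ℂ | IsLinearMap ℂ f}

/-- A subset of a complex module is algebraic (Zariski closed) if it is the common zero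
set of a family of polynomial functions. -/
def IsAlgSet {W : Type*} [AddCommGroup W] [Module ℂ W] (X : Set W) : Prop :=
  ∃ S : Set (W → ℂ), S ⊆ (PolyFun W : Set (W → ℂ)) ∧ X = {x | ∀ f ∈ S, f x = 0}

/-- Zariski closure. -/
def zcl {W : Type*} [AddCommGroup W] [Module ℂ W] (A : Set W) : Set W :=
  ⋂₀ {Y | IsAlgSet Y ∧ A ⊆ Y}

/-- Irreducible algebraic set. -/
def IsIrrAlg {W : Type*} [AddCommGroup W] [Module ℂ W] (X : Set W) : Prop :=
  X.Nonempty ∧ IsAlgSet X ∧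
    ∀ Y Z : Set W, IsAlgSet Y → IsAlgSet Z → X ⊆ Y ∪ Z → X ⊆ Y ∨ X ⊆ Z

/-- Dimension of an (affine) algebraic set: the supremum of the lengths of strict chains
of irreducible algebraic subsets contained in it. -/
def adim {W : Type*} [AddCommGroup W] [Module ℂ W] (X : Set W) : ℕ∞ :=
  sSup {d : ℕ∞ | ∃ n : ℕ, d = (n : ℕ∞) ∧
    ∃ c : Fin (n + 1) → Set W, StrictMono c ∧ ∀ i, IsIrrAlg (c i) ∧ c i ⊆ X}

/-- Projective dimension of a cone: one less than the dimension of the affine cone. -/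
def pdim {W : Type*} [AddCommGroup W] [Module ℂ W] (X : Set W) : ℕ∞ := adim X - 1

/-- A cone in a complex module (the affine cone of a projective set). -/
def IsCone {W : Type*} [AddCommGroup W] [Module ℂ W] (X : Set W) : Prop :=
  (0 : W) ∈ X ∧ ∀ (c : ℂ) (x : W), x ∈ X → c • x ∈ X

/-- The affine cone of an integral projective variety: an irreducible algebraic cone,
different from the origin alone. -/
def IsProjVar {W : Type*} [AddCommGroup W] [Module ℂ W] (X : Set W) : Prop :=
  IsAlgSet X ∧ IsCone X ∧ IsIrrAlg X ∧ X ≠ {0}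

/-- Non-degenerate: the cone spans the ambient space. -/
def Nondeg {W : Type*} [AddCommGroup W] [Module ℂ W] (X : Set W) : Prop :=
  Submodule.span ℂ X = ⊤

/-- The projective set is a cone over some vertex: there is a point `v` (vertex) of the
variety such that the variety is a union of lines through the vertex. -/
def IsConeVar {W : Type*} [AddCommGroup W] [Module ℂ W] (X : Set W) : Prop :=
  ∃ v ∈ X, v ≠ 0 ∧ ∀ x ∈ X, ∀ a b : ℂ, a • v + b • x ∈ X

/-- Affine cone of the `k`-th secant variety `S_k(X)`: the Zariski closure of the union
of the linear spans of `k+1` points of `X`. -/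
def Sec {W : Type*} [AddCommGroup W] [Module ℂ W] (X : Set W) (k : ℕ) : Set W :=
  zcl (⋃ p ∈ {p : Fin (k + 1) → W | ∀ i, p i ∈ X},
    (Submodule.span ℂ (Set.range p) : Set W))

/-- Plücker points of the spans of `(k+1)`-tuples of points of `X`: the raw affine cone
over the image of the span map `Φ : X^{k+1} ⇢ G(k,r)` in Plücker coordinates. -/
def GkConePre {W : Type*} [AddCommGroup W] [Module ℂ W] (X : Set W) (k : ℕ) :
    Set (ExteriorAlgebra ℂ W) :=
  {w | ∃ p : Fin (k + 1) → W, (∀ i, p i ∈ X) ∧ w = ExteriorAlgebra.ιMulti ℂ (k + 1) p}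

/-- Affine cone over `G_k(X)` (in Plücker coordinates): Zariski closure of the cone over
the image of the span map. -/
def GkCone {W : Type*} [AddCommGroup W] [Module ℂ W] (X : Set W) (k : ℕ) :
    Set (ExteriorAlgebra ℂ W) :=
  zcl (GkConePre X k)

/-- `G_k(X)` as a set of `(k+1)`-dimensional subspaces (projective `k`-planes): those
whose Plücker point lies in the closure of the image of the span map. -/
def Gk {W : Type*} [AddCommGroup W] [Module ℂ W] (X : Set W) (k : ℕ) :
    Set (Submodule ℂ W) :=
  {U | Module.finrank ℂ U = k + 1 ∧
    ∀ p : Fin (k + 1) → W, (∀ i, p i ∈ U) →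
      ExteriorAlgebra.ιMulti ℂ (k + 1) p ∈ GkCone X k}

/-- Raw cone of Plücker points of `h`-planes contained in some `(k+1)`-secant `k`-plane. -/
def GhkConePre {W : Type*} [AddCommGroup W] [Module ℂ W] (X : Set W) (h k : ℕ) :
    Set (ExteriorAlgebra ℂ W) :=
  {w | ∃ (p : Fin (k + 1) → W) (q : Fin (h + 1) → W), (∀ i, p i ∈ X) ∧
    (∀ j, q j ∈ Submodule.span ℂ (Set.range p)) ∧
    w = ExteriorAlgebra.ιMulti ℂ (h + 1) q}

/-- Affine cone over `G_{h,k}(X)` in Plücker coordinates. -/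
def GhkCone {W : Type*} [AddCommGroup W] [Module ℂ W] (X : Set W) (h k : ℕ) :
    Set (ExteriorAlgebra ℂ W) :=
  zcl (GhkConePre X h k)

section AlgSets

variable {W W' : Type*} [AddCommGroup W] [Module ℂ W] [AddCommGroup W'] [Module ℂ W']

theorem PolyFun.comp_linearMap {f : W → ℂ} (hf : f ∈ PolyFun W) (L : W' →ₗ[ℂ] W) :
    f ∘ L ∈ PolyFun W' := by
  induction hf using Algebra.adjoin_induction with
  | mem g hg => exact Algebra.subset_adjoin ((hg.mk' g).comp L).isLinear
  | algebraMap c => exact (PolyFun W').algebraMap_mem c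
  | add g₁ g₂ _ _ h₁ h₂ => exact (PolyFun W').add_mem h₁ h₂
  | mul g₁ g₂ _ _ h₁ h₂ => exact (PolyFun W').mul_mem h₁ h₂

theorem IsAlgSet.preimage {Y : Set W} (hY : IsAlgSet Y) (L : W' →ₗ[ℂ] W) :
    IsAlgSet (L ⁻¹' Y) := by
  obtain ⟨S, hS, rfl⟩ := hY
  refine ⟨(fun f => f ∘ L) '' S, ?_, ?_⟩
  · rintro _ ⟨f, hf, rfl⟩
    exact PolyFun.comp_linearMap (hS hf) L
  · ext x
    simp

theorem IsAlgSet.sInter {𝒮 : Set (Set W)} (h : ∀ Y ∈ 𝒮, IsAlgSet Y) : IsAlgSet (⋂₀ 𝒮) := by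
  choose! S hS hY using h
  refine ⟨⋃ Y ∈ 𝒮, S Y, by simpa using hS, ?_⟩
  ext x
  simp only [Set.mem_sInter, Set.mem_iUnion, Set.mem_ofPred_eq]
  refine ⟨fun h f ⟨Y, hY', hf⟩ => ?_, fun h Y hY' => ?_⟩
  · have := h Y hY'
    rw [hY Y hY'] at this
    exact this f hf
  · rw [hY Y hY']
    exact fun f hf => h f ⟨Y, hY', hf⟩

theorem IsAlgSet.inter {Y Z : Set W} (hY : IsAlgSet Y) (hZ : IsAlgSet Z) : IsAlgSet (Y ∩ Z) := by
  rw [← Set.sInter_pair]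
  exact IsAlgSet.sInter (by rintro _ (rfl | rfl) <;> assumption)

theorem isAlgSet_zcl (A : Set W) : IsAlgSet (zcl A) :=
  IsAlgSet.sInter fun _ hY => hY.1

theorem subset_zcl (A : Set W) : A ⊆ zcl A :=
  Set.subset_sInter fun _ hY => hY.2

theorem zcl_subset {A Y : Set W} (hY : IsAlgSet Y) (h : A ⊆ Y) : zcl A ⊆ Y :=
  Set.sInter_subset_of_mem ⟨hY, h⟩

theorem adim_mono {A B : Set W} (h : A ⊆ B) : adim A ≤ adim B :=
  sSup_le_sSup fun _ ⟨n, hd, c, hc, hA⟩ => ⟨n, hd, c, hc, fun i => ⟨(hA i).1, (hA i).2.trans h⟩⟩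

theorem isAlgSet_range_of_leftInverse {L : W' →ₗ[ℂ] W} {R : W →ₗ[ℂ] W'}
    (h : R ∘ₗ L = LinearMap.id) : IsAlgSet (Set.range L) := by
  refine ⟨{f | ∃ φ : W →ₗ[ℂ] ℂ, f = fun w => φ (w - L (R w))}, ?_, ?_⟩
  · rintro _ ⟨φ, rfl⟩
    exact Algebra.subset_adjoin
      (show IsLinearMap ℂ _ from (φ ∘ₗ (LinearMap.id - L ∘ₗ R)).isLinear)
  · have hRL : ∀ x, R (L x) = x := fun x => LinearMap.congr_fun h x
    ext w
    constructor
    · rintro ⟨x, rfl⟩ _ ⟨φ, rfl⟩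
      simp [hRL]
    · intro hw
      refine ⟨R w, (sub_eq_zero.1 ?_).symm⟩
      by_contra hne
      obtain ⟨φ, hφ⟩ := Module.Projective.exists_dual_ne_zero ℂ hne
      exact hφ (hw _ ⟨φ, rfl⟩)

theorem IsIrrAlg.image {Y : Set W'} (hY : IsIrrAlg Y) {L : W' →ₗ[ℂ] W} {R : W →ₗ[ℂ] W'}
    (h : R ∘ₗ L = LinearMap.id) : IsIrrAlg (L '' Y) := by
  have hRL : ∀ x, R (L x) = x := fun x => LinearMap.congr_fun h x
  refine ⟨hY.1.image _, ?_, fun A B hA hB hAB => ?_⟩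
  · have : L '' Y = Set.range L ∩ R ⁻¹' Y := by
      ext w
      constructor
      · rintro ⟨y, hy, rfl⟩
        exact ⟨⟨y, rfl⟩, by simpa [hRL] using hy⟩
      · rintro ⟨⟨y, rfl⟩, hy⟩
        exact ⟨y, by simpa [hRL] using hy, rfl⟩
    rw [this]
    exact (isAlgSet_range_of_leftInverse h).inter (hY.2.1.preimage R)
  · simp only [Set.image_subset_iff] at hAB ⊢
    exact hY.2.2 _ _ (hA.preimage L) (hB.preimage L) hAB

theorem adim_preimage_le {A : Set W} {L : W' →ₗ[ℂ] W} {R : W →ₗ[ℂ] W'}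
    (h : R ∘ₗ L = LinearMap.id) : adim (L ⁻¹' A) ≤ adim A := by
  have hL : Function.Injective L :=
    Function.LeftInverse.injective (g := R) fun x => LinearMap.congr_fun h x
  refine sSup_le_sSup ?_
  rintro _ ⟨n, rfl, c, hc, hA⟩
  refine ⟨n, rfl, fun i => L '' c i, fun i j hij => ?_, fun i => ⟨(hA i).1.image h, ?_⟩⟩
  · exact hL.image_strictMono (hc hij)
  · exact Set.image_subset_iff.2 (hA i).2

/-- Passing to the closure commutes with a split linear embedding, as far as lower bounds on the
dimension are concerned. -/
theorem adim_zcl_preimage_le {A : Set W} {L : W' →ₗ[ℂ] W} {R : W →ₗ[ℂ] W'}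
    (h : R ∘ₗ L = LinearMap.id) : adim (zcl (L ⁻¹' A)) ≤ adim (zcl A) :=
  (adim_mono (zcl_subset ((isAlgSet_zcl A).preimage L)
    (Set.preimage_mono (subset_zcl A)))).trans (adim_preimage_le h)

end AlgSets

section Coordinates

open MvPolynomial

variable {κ : Type*} [Fintype κ]

theorem mem_polyFun_iff {f : (κ → ℂ) → ℂ} :
    f ∈ PolyFun (κ → ℂ) ↔ ∃ F : MvPolynomial κ ℂ, f = fun x => eval x F := by
  classical
  constructor
  · intro hf
    induction hf using Algebra.adjoin_induction with
    | mem g hg =>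
      refine ⟨∑ c, C (g (Pi.single c 1)) * X c, funext fun x => ?_⟩
      have := LinearMap.pi_apply_eq_sum_univ (hg.mk' g) x
      simp only [IsLinearMap.mk'_apply] at this
      rw [this]
      simp only [map_sum, map_mul, eval_C, eval_X, smul_eq_mul]
      refine Finset.sum_congr rfl fun c _ => ?_
      rw [mul_comm]
      congr 2
      ext d
      simp [Pi.single_apply, eq_comm]
    | algebraMap c => exact ⟨C c, by ext; simp⟩
    | add g₁ g₂ _ _ h₁ h₂ =>
      obtain ⟨F, rfl⟩ := h₁
      obtain ⟨G, rfl⟩ := h₂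
      exact ⟨F + G, by ext; simp⟩
    | mul g₁ g₂ _ _ h₁ h₂ =>
      obtain ⟨F, rfl⟩ := h₁
      obtain ⟨G, rfl⟩ := h₂
      exact ⟨F * G, by ext; simp⟩
  · rintro ⟨F, rfl⟩
    induction F using MvPolynomial.induction_on with
    | C a =>
      convert (PolyFun (κ → ℂ)).algebraMap_mem a using 1
      ext; simp
    | add F G hF hG =>
      convert (PolyFun (κ → ℂ)).add_mem hF hG using 1
      ext; simp
    | mul_X F i hF =>
      convert (PolyFun (κ → ℂ)).mul_mem hF (Algebra.subset_adjoin (show IsLinearMap ℂ _ from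
        (LinearMap.proj (R := ℂ) (φ := fun _ : κ => ℂ) i).isLinear)) using 1
      ext; simp

theorem isAlgSet_zeroSet (S : Set (MvPolynomial κ ℂ)) :
    IsAlgSet {x : κ → ℂ | ∀ F ∈ S, eval x F = 0} := by
  refine ⟨(fun F x => eval x F) '' S, ?_, by simp⟩
  rintro _ ⟨F, -, rfl⟩
  exact mem_polyFun_iff.2 ⟨F, rfl⟩

theorem IsAlgSet.mem {X : Set (κ → ℂ)} (hX : IsAlgSet X) {x : κ → ℂ}
    (hx : ∀ F ∈ vanishingIdeal ℂ X, eval x F = 0) : x ∈ X := by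
  obtain ⟨S, hS, hXS⟩ := hX
  rw [hXS]
  intro f hf
  obtain ⟨F, rfl⟩ := mem_polyFun_iff.1 (hS hf)
  refine hx F fun y hy => ?_
  rw [hXS] at hy
  simpa [aeval_eq_eval] using hy _ hf

theorem vanishingIdeal_zcl (A : Set (κ → ℂ)) :
    vanishingIdeal ℂ (zcl A) = vanishingIdeal ℂ A := by
  refine le_antisymm (vanishingIdeal_anti_mono (subset_zcl A)) fun F hF => ?_
  have := zcl_subset (isAlgSet_zeroSet {F}) (A := A) fun x hx => by
    rintro _ rfl
    simpa [aeval_eq_eval] using hF x hx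
  intro x hx
  simpa [aeval_eq_eval] using this hx F rfl

theorem mem_zcl_iff {A : Set (κ → ℂ)} {x : κ → ℂ} :
    x ∈ zcl A ↔ ∀ F ∈ vanishingIdeal ℂ A, eval x F = 0 := by
  constructor
  · intro hx F hF
    rw [← vanishingIdeal_zcl] at hF
    simpa [aeval_eq_eval] using hF x hx
  · intro h
    refine (isAlgSet_zcl A).mem ?_
    rwa [vanishingIdeal_zcl]

theorem vanishingIdeal_lt_of_ssubset {Y Z : Set (κ → ℂ)} (hY : IsAlgSet Y) (h : Y ⊂ Z) :
    vanishingIdeal ℂ Z < vanishingIdeal ℂ Y := by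
  refine lt_of_le_not_ge (vanishingIdeal_anti_mono h.1) fun hle => h.2 fun x hx => hY.mem ?_
  intro F hF
  simpa [aeval_eq_eval] using hle hF x hx

theorem IsIrrAlg.isPrime {X : Set (κ → ℂ)} (hX : IsIrrAlg X) :
    (vanishingIdeal ℂ X).IsPrime := by
  refine ⟨fun h => ?_, fun {F G} hFG => ?_⟩
  · obtain ⟨x, hx⟩ := hX.1
    have : (1 : MvPolynomial κ ℂ) ∈ vanishingIdeal ℂ X := h ▸ Submodule.mem_top
    simpa using this x hx
  · have := hX.2.2 _ _ (isAlgSet_zeroSet {F}) (isAlgSet_zeroSet {G}) fun x hx => by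
      simpa [aeval_eq_eval] using hFG x hx
    refine this.imp (fun h x hx => ?_) (fun h x hx => ?_) <;>
      simpa [aeval_eq_eval] using h hx _ rfl

theorem isIrrAlg_zeroLocus (Q : Ideal (MvPolynomial κ ℂ)) [hQ : Q.IsPrime] :
    IsIrrAlg (zeroLocus ℂ Q) := by
  have hI : vanishingIdeal ℂ (zeroLocus ℂ Q) = Q := IsPrime.vanishingIdeal_zeroLocus Q
  refine ⟨?_, ?_, fun Y Z hY hZ hYZ => ?_⟩
  · by_contra h
    rw [Set.not_nonempty_iff_eq_empty] at h
    rw [h, vanishingIdeal_empty] at hI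
    exact hQ.ne_top hI.symm
  · convert isAlgSet_zeroSet (Q : Set (MvPolynomial κ ℂ)) using 1
    ext x
    simp [aeval_eq_eval]
  · by_contra! h
    obtain ⟨⟨x, hx, hxY⟩, ⟨y, hy, hyZ⟩⟩ := Set.not_subset.1 h.1, Set.not_subset.1 h.2
    obtain ⟨F, hF, hFx⟩ : ∃ F ∈ vanishingIdeal ℂ Y, eval x F ≠ 0 := by
      by_contra! h'
      exact hxY (hY.mem h')
    obtain ⟨G, hG, hGy⟩ : ∃ G ∈ vanishingIdeal ℂ Z, eval y G ≠ 0 := by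
      by_contra! h'
      exact hyZ (hZ.mem h')
    have : F * G ∈ Q := by
      rw [← hI]
      intro z hz
      rcases hYZ hz with h' | h'
      · rw [map_mul, hF z h', zero_mul]
      · rw [map_mul, hG z h', mul_zero]
    rcases hQ.mem_or_mem this with h' | h' <;> rw [← hI] at h'
    · exact hFx (by simpa [aeval_eq_eval] using h' x hx)
    · exact hGy (by simpa [aeval_eq_eval] using h' y hy)

end Coordinates

section Derivations

open MvPolynomial

variable {K : Type*} [Field K] [Algebra ℂ K] [Algebra.EssFiniteType ℂ K]

theorem AlgebraicIndependent.linearIndependent_kaehler {ι : Type*} {x : ι → K}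
    (hx : AlgebraicIndependent ℂ x) :
    LinearIndependent K fun i => KaehlerDifferential.D ℂ K (x i) := by
  let : Algebra (MvPolynomial ι ℂ) K := (aeval x).toAlgebra
  have hmap : ∀ F, algebraMap (MvPolynomial ι ℂ) K F = aeval x F := fun _ => rfl
  have : IsScalarTower ℂ (MvPolynomial ι ℂ) K := .of_algebraMap_eq' (aeval x).comp_algebraMap.symm
  have : FaithfulSMul (MvPolynomial ι ℂ) K :=
    (faithfulSMul_iff_algebraMap_injective _ _).2 hx
  let : Algebra (FractionRing (MvPolynomial ι ℂ)) K := FractionRing.liftAlgebra _ _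
  have : IsScalarTower (MvPolynomial ι ℂ) (FractionRing (MvPolynomial ι ℂ)) K :=
    FractionRing.isScalarTower_liftAlgebra _ _
  have : IsScalarTower ℂ (FractionRing (MvPolynomial ι ℂ)) K := .of_algebraMap_eq fun z => by
    rw [IsScalarTower.algebraMap_apply ℂ (MvPolynomial ι ℂ) (FractionRing _),
      ← IsScalarTower.algebraMap_apply (MvPolynomial ι ℂ) (FractionRing _) K,
      ← IsScalarTower.algebraMap_apply ℂ (MvPolynomial ι ℂ) K]
  have : CharZero (FractionRing (MvPolynomial ι ℂ)) :=
    charZero_of_injective_algebraMap (algebraMap ℂ _).injective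
  have : Algebra.EssFiniteType (FractionRing (MvPolynomial ι ℂ)) K :=
    Algebra.EssFiniteType.of_comp ℂ _ K
  have : Algebra.FormallySmooth (MvPolynomial ι ℂ) (FractionRing (MvPolynomial ι ℂ)) :=
    .of_isLocalization (nonZeroDivisors _)
  have : Algebra.FormallySmooth (MvPolynomial ι ℂ) K :=
    .comp _ (FractionRing (MvPolynomial ι ℂ)) _
  have hinj : Function.Injective (KaehlerDifferential.mapBaseChange ℂ (MvPolynomial ι ℂ) K) := by
    refine (injective_iff_map_eq_zero _).2 fun z hz => ?_
    obtain ⟨y, rfl⟩ := (Algebra.H1Cotangent.exact_δ_mapBaseChange ℂ (MvPolynomial ι ℂ) K z).1 hz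
    rw [Subsingleton.elim y 0, map_zero]
  have hb := (((KaehlerDifferential.mvPolynomialBasis ℂ ι).baseChange K).linearIndependent).map'
    (KaehlerDifferential.mapBaseChange ℂ (MvPolynomial ι ℂ) K) (LinearMap.ker_eq_bot.2 hinj)
  have heq : (fun i => KaehlerDifferential.D ℂ K (x i)) =
      KaehlerDifferential.mapBaseChange ℂ (MvPolynomial ι ℂ) K ∘
        (KaehlerDifferential.mvPolynomialBasis ℂ ι).baseChange K := by
    ext i
    simp [hmap]
  rw [heq]
  exact hb

/-- Derivations can be prescribed arbitrarily on algebraically independent elements. -/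
theorem AlgebraicIndependent.exists_derivation {ι : Type*} {x : ι → K}
    (hx : AlgebraicIndependent ℂ x) (y : ι → K) :
    ∃ D : Derivation ℂ K K, ∀ i, D (x i) = y i := by
  obtain ⟨g, hg⟩ := LinearMap.exists_leftInverse_of_injective _
    (LinearMap.ker_eq_bot.2 hx.linearIndependent_kaehler)
  refine ⟨(Finsupp.linearCombination K y ∘ₗ g).compDer (KaehlerDifferential.D ℂ K), fun i => ?_⟩
  have := LinearMap.congr_fun hg (Finsupp.single i 1)
  simp only [LinearMap.comp_apply, Finsupp.linearCombination_single, one_smul,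
    LinearMap.id_apply] at this
  simp [this]

/-- The chain rule. -/
theorem Derivation.apply_mvPolynomial_aeval {κ A M : Type*} [Fintype κ] [CommRing A] [Algebra ℂ A]
    [AddCommGroup M] [Module A M] [Module ℂ M] [IsScalarTower ℂ A M]
    (D : Derivation ℂ A M) (a : κ → A) (F : MvPolynomial κ ℂ) :
    D (aeval a F) = ∑ c, aeval a (pderiv c F) • D (a c) := by
  classical
  induction F using MvPolynomial.induction_on with
  | C z => simp
  | add F G hF hG => simp [hF, hG, add_smul, Finset.sum_add_distrib]
  | mul_X F i hF =>
    simp only [map_mul, aeval_X, Derivation.leibniz, hF, Finset.smul_sum, smul_smul, pderiv_X,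
      smul_eq_mul, map_add, add_smul, Finset.sum_add_distrib, Pi.single_apply]
    congr 1
    rw [Finset.sum_eq_single i] <;> simp +contextual [eq_comm]

end Derivations

section UpperBound

open MvPolynomial

theorem AlgebraicIndependent.option_of_map_eq_zero {B B' ι : Type*} [CommRing B] [IsDomain B]
    [CommRing B'] [Algebra ℂ B] [Algebra ℂ B'] (φ : B →ₐ[ℂ] B') {x : ι → B}
    (hx : AlgebraicIndependent ℂ (φ ∘ x)) {a : B} (ha : a ≠ 0) (hφ : φ a = 0) :
    AlgebraicIndependent ℂ fun o : Option ι => o.elim a x := by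
  refine AlgebraicIndependent.option_iff.2 ⟨AlgebraicIndependent.of_comp φ hx, fun halg => ?_⟩
  obtain ⟨q, hq0, hq⟩ :=
    halg.exists_nonzero_coeff_and_aeval_eq_zero (mem_nonZeroDivisors_of_ne_zero ha)
  obtain ⟨F, hF⟩ : ∃ F, aeval x F = (q.coeff 0 : B) := by
    have := (q.coeff 0).2
    exact (Algebra.adjoin_range_eq_range_aeval ℂ x).le this
  have h0 : φ (q.coeff 0 : B) = 0 := by
    have h1 := congrArg φ hq
    rw [Polynomial.aeval_eq_sum_range, map_sum, Finset.sum_eq_single 0] at h1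
    · simpa [Algebra.smul_def] using h1
    · intro b _ hb
      simp [Algebra.smul_def, hφ, hb]
    · simp
  apply hq0
  have : F = 0 := by
    refine (injective_iff_map_eq_zero _).1 hx F ?_
    rw [← h0, ← hF, comp_aeval_apply, Function.comp_def]
  ext
  rw [← hF, this]
  simp

theorem exists_algebraicIndependent_of_strictAnti {R : Type*} [CommRing R] [Algebra ℂ R] :
    ∀ {m : ℕ} (Q : Fin (m + 1) → Ideal R), StrictAnti Q → (∀ i, (Q i).IsPrime) →
      ∃ f : Fin m → R, AlgebraicIndependent ℂ fun i => Ideal.Quotient.mk (Q (Fin.last m)) (f i)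
  | 0, Q, _, hp => by
    have := hp (Fin.last 0)
    refine ⟨Fin.elim0, ?_⟩
    rw [algebraicIndependent_empty_type_iff]
    exact (algebraMap ℂ _).injective
  | m + 1, Q, hQ, hp => by
    obtain ⟨f, hf⟩ := exists_algebraicIndependent_of_strictAnti (fun i => Q i.castSucc)
      (fun i j hij => hQ (by simpa using hij)) fun i => hp _
    have hlt : Q (Fin.last (m + 1)) < Q (Fin.last m).castSucc := hQ (Fin.castSucc_lt_last _)
    obtain ⟨a, ha, ha'⟩ := Set.exists_of_ssubset hlt
    have := hp (Fin.last (m + 1))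
    have h := AlgebraicIndependent.option_of_map_eq_zero
      (Ideal.Quotient.factorₐ ℂ hlt.le)
      (x := fun i => Ideal.Quotient.mk (Q (Fin.last (m + 1))) (f i))
      (a := Ideal.Quotient.mk _ a) hf (by rwa [Ne, Ideal.Quotient.eq_zero_iff_mem])
      (by simpa [Ideal.Quotient.eq_zero_iff_mem] using ha)
    refine ⟨fun i => (finSuccEquivLast i).elim a f, ?_⟩
    have heq : (fun i => Ideal.Quotient.mk (Q (Fin.last (m + 1)))
        ((finSuccEquivLast i).elim a f)) = (fun o : Option (Fin m) =>
          o.elim (Ideal.Quotient.mk (Q (Fin.last (m + 1))) a)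
            fun i => Ideal.Quotient.mk (Q (Fin.last (m + 1))) (f i)) ∘ finSuccEquivLast := by
      ext i
      simp only [Function.comp]
      cases finSuccEquivLast i <;> rfl
    rw [heq]
    exact h.comp _ finSuccEquivLast.injective

variable {κ : Type*} [Fintype κ] {K : Type*} [Field K] [Algebra ℂ K] [Algebra.EssFiniteType ℂ K]

/-- The dimension of a variety is at most the dimension of a space containing all images of
a generic point under derivations. -/
theorem adim_le_of_derivations {Z : Set (κ → ℂ)} (g : κ → K)
    (hg : ∀ F : MvPolynomial κ ℂ, aeval g F = 0 → F ∈ vanishingIdeal ℂ Z)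
    (T : Submodule K (κ → K)) (hT : ∀ D : Derivation ℂ K K, (fun c => D (g c)) ∈ T) :
    adim Z ≤ (Module.finrank K T : ℕ∞) := by
  refine sSup_le ?_
  rintro _ ⟨m, rfl, c, hc, hcZ⟩
  obtain ⟨f, hf⟩ := exists_algebraicIndependent_of_strictAnti
    (fun i : Fin (m + 1) => vanishingIdeal ℂ (c i))
    (fun i j hij => vanishingIdeal_lt_of_ssubset (hcZ _).1.2.1 (hc hij))
    fun i => (hcZ _).1.isPrime
  have hgf : AlgebraicIndependent ℂ fun i => aeval g (f i) := by
    refine (injective_iff_map_eq_zero _).2 fun G hG => (injective_iff_map_eq_zero _).1 hf G ?_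
    have h1 : aeval g (aeval f G) = 0 := by
      rw [← hG, comp_aeval_apply]
    have h2 : Ideal.Quotient.mk (vanishingIdeal ℂ (c (Fin.last m))) (aeval f G) = 0 :=
      Ideal.Quotient.eq_zero_iff_mem.2 (vanishingIdeal_anti_mono (hcZ _).2 (hg _ h1))
    rw [← h2, ← Ideal.Quotient.mkₐ_eq_mk ℂ, comp_aeval_apply]
  choose D hD using fun a : Fin m => hgf.exists_derivation (Pi.single a 1)
  let Φ : T →ₗ[K] (Fin m → K) := LinearMap.pi fun b =>
    (∑ c, aeval g (pderiv c (f b)) • LinearMap.proj c) ∘ₗ T.subtype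
  have hΦ : Function.Surjective Φ := by
    rw [← LinearMap.range_eq_top, eq_top_iff, ← (Pi.basisFun K (Fin m)).span_eq,
      Submodule.span_le]
    rintro _ ⟨a, rfl⟩
    refine ⟨⟨_, hT (D a)⟩, funext fun b => ?_⟩
    have := hD a b
    rw [Derivation.apply_mvPolynomial_aeval] at this
    simpa [Φ] using this
  have := LinearMap.finrank_le_finrank_of_surjective hΦ
  simpa using this

end UpperBound

section LowerBound

open MvPolynomial

variable {κ : Type*} [Finite κ]

theorem zeroLocus_ssubset_of_lt {P Q : Ideal (MvPolynomial κ ℂ)} [P.IsPrime] [Q.IsPrime]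
    (h : P < Q) : zeroLocus ℂ Q ⊂ zeroLocus ℂ P := by
  refine ⟨zeroLocus_anti_mono h.le, fun hle => h.not_ge ?_⟩
  rw [← IsPrime.vanishingIdeal_zeroLocus (K := ℂ) P, ← IsPrime.vanishingIdeal_zeroLocus (K := ℂ) Q]
  exact vanishingIdeal_anti_mono hle

theorem le_ringKrullDim_of_algebraicIndependent {B : Type*} [CommRing B] [IsDomain B] [Algebra ℂ B]
    [Algebra.FiniteType ℂ B] {d : ℕ} {f : Fin d → B} (hf : AlgebraicIndependent ℂ f) :
    ∃ l : LTSeries (PrimeSpectrum B), d ≤ l.length := by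
  obtain ⟨s, g, hg, hint⟩ := exists_integral_inj_algHom_of_fg ℂ B
  let : Algebra (MvPolynomial (Fin s) ℂ) B := g.toRingHom.toAlgebra
  have : IsScalarTower ℂ (MvPolynomial (Fin s) ℂ) B := .of_algebraMap_eq' g.comp_algebraMap.symm
  have : Algebra.IsIntegral (MvPolynomial (Fin s) ℂ) B := ⟨hint⟩
  have hX : AlgebraicIndependent ℂ fun i => g (X i) :=
    (algebraicIndependent_X (Fin s) ℂ).map' hg
  have hb : IsTranscendenceBasis ℂ fun i => g (X i) := by
    refine hX.isTranscendenceBasis_iff_isAlgebraic.2 ⟨fun b => ?_⟩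
    let : Algebra (MvPolynomial (Fin s) ℂ) (Algebra.adjoin ℂ (Set.range fun i => g (X i))) :=
      hX.aevalEquiv.toAlgHom.toRingHom.toAlgebra
    have : IsScalarTower (MvPolynomial (Fin s) ℂ)
        (Algebra.adjoin ℂ (Set.range fun i => g (X i))) B := .of_algebraMap_eq fun F => by
      change g F = algebraMap _ B (hX.aevalEquiv F)
      rw [hX.algebraMap_aevalEquiv F, ← comp_aeval_apply, aeval_X_left_apply]
    exact ((Algebra.IsIntegral.isIntegral (R := MvPolynomial (Fin s) ℂ) b).tower_top).isAlgebraic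
  have hds : d ≤ s := by
    have h1 := hf.lift_cardinalMk_le_trdeg
    rw [← hb.lift_cardinalMk_eq_trdeg] at h1
    simpa using h1
  have hdim : (s : WithBot ℕ∞) ≤ ringKrullDim (MvPolynomial (Fin s) ℂ) := by
    rw [MvPolynomial.ringKrullDim_of_isNoetherianRing]
    simp
  obtain ⟨l, hl⟩ := Order.le_krullDim_iff.1 hdim
  have := Algebra.HasGoingUp.of_isIntegral (R := MvPolynomial (Fin s) ℂ) (S := B)
  obtain ⟨P, -, hP, hPl⟩ := Ideal.exists_ideal_over_prime_of_isIntegral l.head.asIdeal (⊥ : Ideal B)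
    (by
      rw [← RingHom.ker_eq_comap_bot]
      exact ((RingHom.injective_iff_ker_eq_bot _).1 hg).le.trans bot_le)
  have : P.LiesOver l.head.asIdeal := ⟨hPl.symm⟩
  obtain ⟨L, hL, -⟩ := Ideal.exists_ltSeries_of_hasGoingUp l P
  exact ⟨L, by rw [hL, hl]; exact hds⟩

/-- The dimension of a variety is at least the number of functions on it which are
algebraically independent. -/
theorem le_adim {κ : Type*} [Fintype κ] {A : Set (κ → ℂ)} (hA : (vanishingIdeal ℂ A).IsPrime)
    {d : ℕ} (f : Fin d → MvPolynomial κ ℂ)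
    (hf : ∀ G : MvPolynomial (Fin d) ℂ, aeval f G ∈ vanishingIdeal ℂ A → G = 0) :
    (d : ℕ∞) ≤ adim (zcl A) := by
  have hf' : AlgebraicIndependent ℂ fun b => Ideal.Quotient.mkₐ ℂ (vanishingIdeal ℂ A) (f b) := by
    refine (injective_iff_map_eq_zero _).2 fun G hG => hf G ?_
    rw [← comp_aeval_apply] at hG
    exact Ideal.Quotient.eq_zero_iff_mem.1 hG
  obtain ⟨l, hl⟩ := le_ringKrullDim_of_algebraicIndependent hf'
  refine (Nat.cast_le.2 hl).trans (le_sSup ⟨l.length, rfl,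
    fun i => zeroLocus ℂ ((l i.rev).asIdeal.comap (Ideal.Quotient.mk (vanishingIdeal ℂ A))),
    fun i j hij => zeroLocus_ssubset_of_lt ?_, fun i => ⟨isIrrAlg_zeroLocus _, fun x hx => ?_⟩⟩)
  · have h := l.strictMono (Fin.rev_lt_rev.2 hij)
    refine lt_of_le_of_ne (Ideal.comap_mono h.le) fun he => h.ne ?_
    exact PrimeSpectrum.ext (Ideal.comap_injective_of_surjective _ Ideal.Quotient.mk_surjective he)
  · refine mem_zcl_iff.2 fun F hF => ?_
    have : F ∈ (l i.rev).asIdeal.comap (Ideal.Quotient.mk (vanishingIdeal ℂ A)) := by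
      rw [Ideal.mem_comap, Ideal.Quotient.eq_zero_iff_mem.2 hF]
      exact zero_mem _
    simpa [aeval_eq_eval] using hx F this

end LowerBound

section Jacobian

open MvPolynomial

theorem MvPolynomial.totalDegree_pderiv_le {σ R : Type*} [CommSemiring R] (F : MvPolynomial σ R)
    (i : σ) : (pderiv i F).totalDegree ≤ F.totalDegree - 1 := by
  refine Finset.sup_le fun m hm => ?_
  rw [mem_support_iff, coeff_pderiv] at hm
  have h := le_totalDegree (mem_support_iff.2 (left_ne_zero_of_mul hm))
  rw [Finsupp.sum_add_index' (by simp) (by simp), Finsupp.sum_single_index rfl] at h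
  omega

theorem MvPolynomial.eq_C_of_pderiv_eq_zero {σ : Type*} {F : MvPolynomial σ ℂ}
    (h : ∀ i, pderiv i F = 0) : F = C (coeff 0 F) := by
  classical
  ext m
  rw [coeff_C]
  split_ifs with hm
  · rw [hm]
  · obtain ⟨i, hi⟩ := Finsupp.ne_iff.1 (Ne.symm hm)
    obtain ⟨m', rfl⟩ : ∃ m', m = m' + Finsupp.single i 1 := by
      refine ⟨m - Finsupp.single i 1, (tsub_add_cancel_of_le ?_).symm⟩
      simpa [Nat.one_le_iff_ne_zero] using hi
    have := coeff_pderiv (i := i) F m'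
    rw [h i, coeff_zero] at this
    exact (mul_eq_zero.1 this.symm).resolve_right (Nat.cast_add_one_ne_zero _)

/-- The easy direction of the Jacobian criterion. -/
theorem algebraicIndependent_of_det_ne_zero {σ B : Type*} [Fintype σ] [CommRing B] [IsDomain B]
    [Algebra ℂ B] {d : ℕ} (g : σ → B) (f : Fin d → MvPolynomial σ ℂ) (w : Fin d → σ → B)
    (hw : ∀ a (F : MvPolynomial σ ℂ), aeval g F = 0 → ∑ s, aeval g (pderiv s F) * w a s = 0)
    (hdet : (Matrix.of fun a b => ∑ s, aeval g (pderiv s (f b)) * w a s).det ≠ 0) :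
    AlgebraicIndependent ℂ fun b => aeval g (f b) := by
  refine (injective_iff_map_eq_zero _).2 fun G hG => ?_
  induction hN : G.totalDegree using Nat.strong_induction_on generalizing G with
  | _ N ih =>
    subst hN
    have hconst : G.totalDegree = 0 → G = 0 := fun h0 => by
      rw [totalDegree_eq_zero_iff_eq_C] at h0
      rw [h0, aeval_C, map_eq_zero_iff _ (algebraMap ℂ B).injective] at hG
      rw [h0, hG, C_0]
    by_cases h0 : G.totalDegree = 0
    · exact hconst h0
    have hF : aeval g (aeval f G) = 0 := by rw [← hG, comp_aeval_apply]
    have hv : Matrix.mulVec (Matrix.of fun a b => ∑ s, aeval g (pderiv s (f b)) * w a s)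
        (fun b => aeval (fun b => aeval g (f b)) (pderiv b G)) = 0 := by
      ext a
      have := hw a _ hF
      simp_rw [Derivation.apply_mvPolynomial_aeval, map_sum, smul_eq_mul, map_mul,
        comp_aeval_apply, Finset.sum_mul] at this
      rw [Finset.sum_comm] at this
      simp only [Matrix.mulVec, dotProduct, Matrix.of_apply, Pi.zero_apply, Finset.sum_mul]
      rw [← this]
      exact Finset.sum_congr rfl fun b _ => Finset.sum_congr rfl fun s _ => by ring
    have hz := Matrix.eq_zero_of_mulVec_eq_zero hdet hv
    refine hconst ?_
    rw [eq_C_of_pderiv_eq_zero fun b => ih _ ?_ (pderiv b G) (congrFun hz b) rfl,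
      totalDegree_C]
    have := totalDegree_pderiv_le G b
    omega

end Jacobian

section BaseChange

variable {L K κ : Type*} [Field L] [Field K] [Algebra L K]

theorem sum_mul_eq_zero_of_forall_functional {M : Type*} (s : Finset M) (c q : M → K)
    (h : ∀ φ : K →ₗ[L] L, ∑ m ∈ s, algebraMap L K (φ (c m)) * q m = 0) :
    ∑ m ∈ s, c m * q m = 0 := by
  classical
  let b := Module.Basis.ofVectorSpace L K
  let A : Finset _ := s.biUnion fun m => (b.repr (c m)).support
  have hc : ∀ m ∈ s, c m = ∑ a ∈ A, algebraMap L K (b.coord a (c m)) * b a := by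
    intro m hm
    conv_lhs => rw [← b.linearCombination_repr (c m), Finsupp.linearCombination_apply]
    rw [Finsupp.sum_of_support_subset _ (Finset.subset_biUnion_of_mem
      (fun m => (b.repr (c m)).support) hm) _ (by simp)]
    simp [A, Algebra.smul_def]
  calc ∑ m ∈ s, c m * q m
      = ∑ m ∈ s, ∑ a ∈ A, b a * (algebraMap L K (b.coord a (c m)) * q m) := by
        refine Finset.sum_congr rfl fun m hm => ?_
        conv_lhs => rw [hc m hm, Finset.sum_mul]
        exact Finset.sum_congr rfl fun a _ => by ring
    _ = 0 := by
        rw [Finset.sum_comm]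
        exact Finset.sum_eq_zero fun a _ => by rw [← Finset.mul_sum, h, mul_zero]

variable [Fintype κ]

/-- The solutions over an extension field of a linear system are spanned by its solutions over
the base field. -/
theorem mem_span_solutions (S : Set (κ → L)) {v : κ → K}
    (hv : ∀ s ∈ S, ∑ c, algebraMap L K (s c) * v c = 0) :
    v ∈ span K {w : κ → K | ∃ u : κ → L, (∀ s ∈ S, ∑ c, s c * u c = 0) ∧
      w = fun c => algebraMap L K (u c)} := by
  classical
  let b := Module.Basis.ofVectorSpace L K
  let A : Finset _ := Finset.univ.biUnion fun c => (b.repr (v c)).support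
  have hvA : v = ∑ a ∈ A, b a • fun c => algebraMap L K (b.coord a (v c)) := by
    ext c
    conv_lhs => rw [← b.linearCombination_repr (v c), Finsupp.linearCombination_apply]
    rw [Finsupp.sum_of_support_subset _ (Finset.subset_biUnion_of_mem
      (fun m => (b.repr (v m)).support) (Finset.mem_univ c)) _ (by simp)]
    simp [A, Algebra.smul_def, mul_comm]
  rw [hvA]
  refine Submodule.sum_mem _ fun a _ => Submodule.smul_mem _ _ (subset_span ⟨_, fun s hs => ?_, rfl⟩)
  have := congrArg (b.coord a) (hv s hs)
  simpa [← Algebra.smul_def] using this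

theorem exists_ne_zero_solution (S : Set (κ → L)) {v : κ → K} (hv0 : v ≠ 0)
    (hv : ∀ s ∈ S, ∑ c, algebraMap L K (s c) * v c = 0) :
    ∃ u : κ → L, u ≠ 0 ∧ ∀ s ∈ S, ∑ c, s c * u c = 0 := by
  by_contra! h
  refine hv0 ?_
  have := mem_span_solutions S hv
  rw [span_eq_bot.2] at this
  · exact this
  · rintro _ ⟨u, hu, rfl⟩
    by_contra hne
    obtain ⟨s, hs, hs'⟩ := h u fun h0 => hne (by ext; simp [h0])
    exact hs' (hu s hs)

theorem exists_functional_of_span_ne_top {S : Set (κ → L)}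
    (hS : span K ((fun (u : κ → L) c => algebraMap L K (u c)) '' S) ≠ ⊤) :
    ∃ θ : κ → L, θ ≠ 0 ∧
      ∀ v ∈ span K ((fun (u : κ → L) c => algebraMap L K (u c)) '' S),
        ∑ c, algebraMap L K (θ c) * v c = 0 := by
  classical
  have hne : span L S ≠ ⊤ := by
    intro h
    refine hS (eq_top_iff.2 ?_)
    rw [← (Pi.basisFun K κ).span_eq, span_le]
    rintro _ ⟨c, rfl⟩
    have hc : Pi.single c (1 : L) ∈ span L S := h ▸ mem_top
    have : ∀ u ∈ span L S, (fun c => algebraMap L K (u c)) ∈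
        span K ((fun (u : κ → L) c => algebraMap L K (u c)) '' S) := by
      intro u hu
      induction hu using span_induction with
      | mem u hu => exact subset_span ⟨u, hu, rfl⟩
      | zero => simpa using! zero_mem _
      | add u u' _ _ h h' => simpa using! add_mem h h'
      | smul a u _ h =>
        convert smul_mem _ (algebraMap L K a) h using 1
        ext
        simp
    have heq : Pi.basisFun K κ c = fun d => algebraMap L K ((Pi.single c 1 : κ → L) d) := by
      ext d
      simp [Pi.single_apply, apply_ite]
    rw [heq]
    exact this _ hc
  obtain ⟨φ, hφ, hφS⟩ := Submodule.exists_dual_map_eq_bot_of_lt_top (lt_top_iff_ne_top.2 hne)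
    inferInstance
  refine ⟨fun c => φ (Pi.single c 1), fun h => hφ ?_, fun v hv => ?_⟩
  · refine (Pi.basisFun L κ).ext fun c => ?_
    simpa using congrFun h c
  · induction hv using span_induction with
    | mem v hv =>
      obtain ⟨u, hu, rfl⟩ := hv
      have h0 : φ u = 0 := by
        have : φ u ∈ (span L S).map φ := ⟨u, subset_span hu, rfl⟩
        rwa [hφS] at this
      rw [LinearMap.pi_apply_eq_sum_univ φ u] at h0
      have := congrArg (algebraMap L K) h0
      rw [map_sum, map_zero] at this
      rw [← this]
      refine Finset.sum_congr rfl fun c _ => ?_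
      rw [smul_eq_mul, map_mul, mul_comm]
      have hc : (Pi.single c 1 : κ → L) = fun j => if c = j then 1 else 0 :=
        funext fun d => by rw [Pi.single_apply]; simp only [eq_comm]
      simp only [hc]
    | zero => simp
    | add v v' _ _ h h' => simp [mul_add, Finset.sum_add_distrib, h, h']
    | smul a v _ h =>
      simp only [Pi.smul_apply, smul_eq_mul, mul_left_comm _ a]
      rw [← Finset.mul_sum, h, mul_zero]

end BaseChange

section GenericPoint

open MvPolynomial Function

/-- Replace the variables of all blocks but the `i`-th one by numbers. -/
def slot {ι κ : Type} [DecidableEq ι] (i : ι) (z : ι → κ → ℂ) :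
    MvPolynomial (ι × κ) ℂ →ₐ[ℂ] MvPolynomial κ ℂ :=
  aeval fun s => if s.1 = i then X s.2 else C (z s.1 s.2)

/-- Replace the variables of the `i`-th block by numbers. -/
def fixSlot {ι κ : Type} [DecidableEq ι] {R : Type*} [CommRing R] [Algebra ℂ R] (i : ι)
    (x : κ → R) : MvPolynomial (ι × κ) ℂ →ₐ[ℂ] MvPolynomial (ι × κ) R :=
  aeval fun s => if s.1 = i then C (x s.2) else X s

/-- A generic point of the power `X ^ ι`, with coordinates in a field. -/
def IsGeneric {ι κ K : Type} [Field K] [Algebra ℂ K] (X : Set (κ → ℂ)) (p : ι → κ → K) : Prop :=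
  ∀ F : MvPolynomial (ι × κ) ℂ, aeval (uncurry p) F = 0 ↔
    ∀ P : ι → κ → ℂ, (∀ i, P i ∈ X) → aeval (uncurry P) F = 0

section Slot

variable {ι κ : Type} [DecidableEq ι] {R : Type*} [CommRing R] [Algebra ℂ R]

theorem aeval_slot (i : ι) (z : ι → κ → ℂ) (x : κ → R)
    (F : MvPolynomial (ι × κ) ℂ) : aeval x (slot i z F) =
      aeval (uncurry (update (fun j c => algebraMap ℂ R (z j c)) i x)) F := by
  rw [slot, comp_aeval_apply]
  congr 2
  ext ⟨j, c⟩
  by_cases h : j = i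
  · subst h; simp
  · simp [h]

theorem aeval_slot_complex (i : ι) (z : ι → κ → ℂ) (x : κ → ℂ)
    (F : MvPolynomial (ι × κ) ℂ) : aeval x (slot i z F) = aeval (uncurry (update z i x)) F :=
  aeval_slot i z x F

theorem eval_fixSlot (i : ι) (x : κ → R) (z : ι → κ → R) (F : MvPolynomial (ι × κ) ℂ) :
    eval (uncurry z) (fixSlot i x F) = aeval (uncurry (update z i x)) F := by
  rw [fixSlot, ← coe_aeval_eq_eval, RingHom.coe_coe, ← AlgHom.restrictScalars_apply ℂ,
    comp_aeval_apply]
  congr 2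
  ext ⟨j, c⟩
  by_cases h : j = i
  · subst h; simp
  · simp [h]

theorem aeval_fixSlot_complex (i : ι) (x : κ → ℂ) (z : ι → κ → R) (F : MvPolynomial (ι × κ) ℂ) :
    aeval (uncurry z) (fixSlot i x F) =
      aeval (uncurry (update z i fun c => algebraMap ℂ R (x c))) F := by
  rw [fixSlot, comp_aeval_apply]
  congr 2
  ext ⟨j, c⟩
  by_cases h : j = i
  · subst h; simp
  · simp [h]

theorem pderiv_slot [Fintype κ] [Fintype ι] (i : ι) (z : ι → κ → ℂ) (c : κ)
    (F : MvPolynomial (ι × κ) ℂ) : pderiv c (slot i z F) = slot i z (pderiv (i, c) F) := by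
  classical
  rw [slot, Derivation.apply_mvPolynomial_aeval, Finset.sum_eq_single (i, c)]
  · simp
  · rintro ⟨j, d⟩ - h
    by_cases hj : j = i
    · subst hj
      have : d ≠ c := fun h' => h (by rw [h'])
      simp [pderiv_X, this]
    · simp [hj]
  · simp

theorem update_mem {X : Set (κ → ℂ)} {P : ι → κ → ℂ} (hP : ∀ i, P i ∈ X) (i : ι) {x : κ → ℂ}
    (hx : x ∈ X) (j : ι) : update P i x j ∈ X := by
  by_cases h : j = i
  · subst h; simpa
  · simpa [h] using hP j

end Slot

variable {ι κ : Type} [Fintype ι] [Fintype κ]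

theorem IsIrrAlg.pi_eq_zero_or {X : Set (κ → ℂ)} (hX : IsIrrAlg X) {F G : MvPolynomial (ι × κ) ℂ}
    (hFG : ∀ P : ι → κ → ℂ, (∀ i, P i ∈ X) → aeval (uncurry P) (F * G) = 0) :
    (∀ P : ι → κ → ℂ, (∀ i, P i ∈ X) → aeval (uncurry P) F = 0) ∨
      ∀ P : ι → κ → ℂ, (∀ i, P i ∈ X) → aeval (uncurry P) G = 0 := by
  classical
  have key : ∀ s : Finset ι, ∀ P : ι → κ → ℂ, (∀ i, P i ∈ X) →
      (∀ P' : ι → κ → ℂ, (∀ i, P' i ∈ X) → (∀ i ∉ s, P' i = P i) → aeval (uncurry P') F = 0) ∨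
      (∀ P' : ι → κ → ℂ, (∀ i, P' i ∈ X) → (∀ i ∉ s, P' i = P i) →
        aeval (uncurry P') G = 0) := by
    intro s
    induction s using Finset.induction_on with
    | empty =>
      intro P hP
      have := hFG P hP
      rw [map_mul, mul_eq_zero] at this
      refine this.imp (fun h P' _ h' => ?_) (fun h P' _ h' => ?_) <;>
        rwa [show P' = P from funext fun i => h' i (Finset.notMem_empty i)]
    | insert i s hi ih =>
      intro P hP
      let S (H : MvPolynomial (ι × κ) ℂ) : Set (MvPolynomial κ ℂ) :=
        {f | ∃ P' : ι → κ → ℂ, (∀ i, P' i ∈ X) ∧ (∀ j ∉ insert i s, P' j = P j) ∧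
          f = slot i P' H}
      have hS : ∀ H, ∀ x ∈ X, (∀ P' : ι → κ → ℂ, (∀ i, P' i ∈ X) →
          (∀ j ∉ s, P' j = update P i x j) → aeval (uncurry P') H = 0) →
          x ∈ {x : κ → ℂ | ∀ f ∈ S H, eval x f = 0} := by
        rintro H x hx h _ ⟨P', hP', hP'', rfl⟩
        have := h (update P' i x) (update_mem hP' i hx) fun j hj => by
          by_cases hji : j = i
          · subst hji; simp
          · simpa [hji] using hP'' j (by simp [hji, hj])
        rw [← aeval_slot_complex] at this
        simpa [aeval_eq_eval] using this
      have hS' : ∀ H, X ⊆ {x : κ → ℂ | ∀ f ∈ S H, eval x f = 0} → ∀ P' : ι → κ → ℂ,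
          (∀ i, P' i ∈ X) → (∀ j ∉ insert i s, P' j = P j) → aeval (uncurry P') H = 0 := by
        intro H h P' hP' hP''
        have := h (hP' i) _ ⟨P', hP', hP'', rfl⟩
        rw [← update_eq_self i P', ← aeval_slot_complex]
        simpa [aeval_eq_eval] using this
      refine (hX.2.2 _ _ (isAlgSet_zeroSet (S F)) (isAlgSet_zeroSet (S G)) fun x hx => ?_).imp
        (hS' F) (hS' G)
      exact (ih (update P i x) (update_mem hP i hx)).imp (hS F x hx) (hS G x hx)
  obtain ⟨x, hx⟩ := hX.1
  exact (key Finset.univ (fun _ => x) fun _ => hx).imp (fun h P hP => h P hP (by simp))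
    (fun h P hP => h P hP (by simp))

theorem IsIrrAlg.exists_isGeneric (ι : Type) [Fintype ι] {X : Set (κ → ℂ)} (hX : IsIrrAlg X) :
    ∃ (K : Type) (_ : Field K) (_ : Algebra ℂ K) (_ : Algebra.EssFiniteType ℂ K)
      (p : ι → κ → K), IsGeneric X p := by
  let I : Ideal (MvPolynomial (ι × κ) ℂ) :=
    vanishingIdeal ℂ {y : ι × κ → ℂ | ∀ i, curry y i ∈ X}
  have hI : ∀ F, F ∈ I ↔ ∀ P : ι → κ → ℂ, (∀ i, P i ∈ X) → aeval (uncurry P) F = 0 :=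
    fun F => ⟨fun h P hP => h (uncurry P) hP, fun h y hy => by simpa using h (curry y) hy⟩
  have hIp : I.IsPrime := by
    refine ⟨fun h => ?_, fun {F G} h => ?_⟩
    · obtain ⟨x, hx⟩ := hX.1
      have := (hI 1).1 (h ▸ Submodule.mem_top) (fun _ => x) fun _ => hx
      simp at this
    · rw [hI] at h
      rw [hI, hI]
      exact hX.pi_eq_zero_or h
  have hess : Algebra.EssFiniteType ℂ (FractionRing (MvPolynomial (ι × κ) ℂ ⧸ I)) :=
    have : Algebra.EssFiniteType (MvPolynomial (ι × κ) ℂ ⧸ I)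
        (FractionRing (MvPolynomial (ι × κ) ℂ ⧸ I)) :=
      Algebra.EssFiniteType.of_isLocalization _ (nonZeroDivisors (MvPolynomial (ι × κ) ℂ ⧸ I))
    Algebra.EssFiniteType.comp ℂ (MvPolynomial (ι × κ) ℂ ⧸ I) _
  refine ⟨FractionRing (MvPolynomial (ι × κ) ℂ ⧸ I), inferInstance, inferInstance, hess,
    fun i c => algebraMap _ _ (Ideal.Quotient.mkₐ ℂ I (MvPolynomial.X (i, c))), fun F => ?_⟩
  rw [← hI]
  have : aeval (uncurry fun i c => algebraMap (MvPolynomial (ι × κ) ℂ ⧸ I)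
      (FractionRing (MvPolynomial (ι × κ) ℂ ⧸ I)) (Ideal.Quotient.mkₐ ℂ I (MvPolynomial.X (i, c)))) F =
      algebraMap _ _ (Ideal.Quotient.mkₐ ℂ I F) := by
    rw [← IsScalarTower.coe_toAlgHom' ℂ (MvPolynomial (ι × κ) ℂ ⧸ I), ← AlgHom.comp_apply]
    refine congrArg (fun φ : MvPolynomial (ι × κ) ℂ →ₐ[ℂ] _ => φ F) (?_ : aeval _ = _)
    ext ⟨i, c⟩
    simp [uncurry]
  rw [this, FaithfulSMul.algebraMap_eq_zero_iff]
  exact Ideal.Quotient.eq_zero_iff_mem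

end GenericPoint

section Tangent

open MvPolynomial Function

/-- The tangent space to the zero set of the ideal of `X` at a point with coordinates in a
field extension. -/
def tan {κ K : Type} [Fintype κ] [Field K] [Algebra ℂ K] (X : Set (κ → ℂ)) (q : κ → K) :
    Submodule K (κ → K) where
  carrier := {v | ∀ f ∈ vanishingIdeal ℂ X, ∑ c, aeval q (pderiv c f) * v c = 0}
  add_mem' hv hw f hf := by
    simp [mul_add, Finset.sum_add_distrib, hv f hf, hw f hf]
  zero_mem' f hf := by simp
  smul_mem' a v hv f hf := by
    simp only [Pi.smul_apply, smul_eq_mul, mul_left_comm _ a]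
    rw [← Finset.mul_sum, hv f hf, mul_zero]

variable {ι κ K : Type} [Field K] [Algebra ℂ K] {X : Set (κ → ℂ)} {p : ι → κ → K}

/-- The field generated by the coordinates of all points but the `i`-th one. -/
def otherField (p : ι → κ → K) (i : ι) : IntermediateField ℂ K :=
  IntermediateField.adjoin ℂ {a | ∃ j, j ≠ i ∧ ∃ c, a = p j c}

theorem mem_otherField {i j : ι} (hj : j ≠ i) (c : κ) : p j c ∈ otherField p i :=
  IntermediateField.subset_adjoin _ _ ⟨j, hj, c, rfl⟩

theorem aeval_mem_otherField {i j : ι} (hj : j ≠ i) (f : MvPolynomial κ ℂ) :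
    aeval (p j) f ∈ otherField p i := by
  have : aeval (p j) f = algebraMap (otherField p i) K
      (aeval (fun c => (⟨p j c, mem_otherField hj c⟩ : otherField p i)) f) := by
    rw [← IsScalarTower.coe_toAlgHom' ℂ (otherField p i) K, comp_aeval_apply]
    rfl
  rw [this]
  exact SetLike.coe_mem _

theorem sum_mul_pderiv_mem [Fintype κ] (hX : IsCone X) {f : MvPolynomial κ ℂ} (hf : f ∈ vanishingIdeal ℂ X) :
    ∑ c, pderiv c f * MvPolynomial.X c ∈ vanishingIdeal ℂ X := by
  intro x hx
  let u : Polynomial ℂ := aeval (fun c => Polynomial.C (x c) * Polynomial.X) f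
  have hu : u = 0 := by
    refine Polynomial.funext fun t => ?_
    have h := hf _ (hX.2 t x hx)
    rw [← Polynomial.coe_aeval_eq_eval, map_zero, ← h, comp_aeval_apply]
    congr 2
    ext c
    rw [Pi.smul_apply, smul_eq_mul]
    simp only [map_mul, Polynomial.aeval_C, Polynomial.aeval_X, Algebra.algebraMap_self_apply]
    exact mul_comm _ _
  have hd : Polynomial.derivative' u = 0 := by rw [hu, map_zero]
  simp only [u] at hd
  rw [Derivation.apply_mvPolynomial_aeval] at hd
  have h1 := congrArg (Polynomial.aeval (1 : ℂ)) hd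
  rw [map_sum, map_zero] at h1
  rw [map_sum, ← h1]
  refine Finset.sum_congr rfl fun c _ => ?_
  rw [smul_eq_mul, map_mul, map_mul, comp_aeval_apply]
  congr 1
  · congr 2
    ext c
    simp
  · simp

theorem tan_le_span_otherField [Fintype κ] (X : Set (κ → ℂ)) {i j : ι} (hj : j ≠ i) : tan X (p j) ≤
    span K ((fun (u : κ → otherField p i) c => algebraMap (otherField p i) K (u c)) ''
      {u | (fun c => algebraMap (otherField p i) K (u c)) ∈ tan X (p j)}) := by
  intro v hv
  let S : Set (κ → otherField p i) := {s | ∃ f ∈ vanishingIdeal ℂ X,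
    s = fun c => ⟨aeval (p j) (pderiv c f), aeval_mem_otherField hj _⟩}
  have := mem_span_solutions S (v := v) (by rintro _ ⟨f, hf, rfl⟩; exact hv f hf)
  refine span_mono ?_ this
  rintro _ ⟨u, hu, rfl⟩
  refine ⟨u, fun f hf => ?_, rfl⟩
  simpa using congrArg (algebraMap (otherField p i) K) (hu _ ⟨f, hf, rfl⟩)

theorem IsConeVar.of_forall_pderiv [Fintype κ] (hX : IsAlgSet X) (hc : IsCone X) {v : κ → ℂ} (hv0 : v ≠ 0)
    (hv : ∀ f ∈ vanishingIdeal ℂ X, ∀ x ∈ X, ∑ c, aeval x (pderiv c f) * v c = 0) :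
    IsConeVar X := by
  have key : ∀ d : ℕ, ∀ f ∈ vanishingIdeal ℂ X, f.totalDegree ≤ d → ∀ x ∈ X,
      aeval (fun c => Polynomial.C (x c) + Polynomial.C (v c) * Polynomial.X) f =
        (0 : Polynomial ℂ) := by
    intro d
    induction d with
    | zero =>
      intro f hf hfd x hx
      rw [totalDegree_eq_zero_iff_eq_C.1 (Nat.le_zero.1 hfd)] at hf ⊢
      have := hf x hx
      rw [aeval_C] at this ⊢
      have h0 : coeff 0 f = 0 := this
      rw [h0, map_zero]
    | succ d ih =>
      intro f hf hfd x hx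
      let g := ∑ c, pderiv c f * C (v c)
      have hg : g ∈ vanishingIdeal ℂ X := fun y hy => by simpa [g] using hv f hf y hy
      have hgd : g.totalDegree ≤ d := by
        refine (totalDegree_finsetSum _ _).trans (Finset.sup_le fun c _ => ?_)
        refine (totalDegree_mul _ _).trans ?_
        have := totalDegree_pderiv_le f c
        rw [totalDegree_C]
        omega
      have hd := ih g hg hgd x hx
      have hu : Polynomial.derivative' (R := ℂ)
          (aeval (fun c => Polynomial.C (x c) + Polynomial.C (v c) * Polynomial.X) f) = 0 := by
        rw [Derivation.apply_mvPolynomial_aeval, ← hd, map_sum]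
        refine Finset.sum_congr rfl fun c _ => ?_
        rw [smul_eq_mul, map_mul]
        simp
      have hC := Polynomial.eq_C_of_derivative_eq_zero (R := ℂ) hu
      have hx' : (fun c => Polynomial.aeval (0 : ℂ)
          (Polynomial.C (x c) + Polynomial.C (v c) * Polynomial.X)) = x := by
        ext c
        simp
      refine hC.trans ?_
      rw [Polynomial.coeff_zero_eq_aeval_zero, comp_aeval_apply, hx', hf x hx, map_zero]
  have hmem : ∀ x ∈ X, ∀ s : ℂ, x + s • v ∈ X := by
    intro x hx s
    refine hX.mem fun f hf => ?_
    have := congrArg (Polynomial.aeval s) (key _ f hf le_rfl x hx)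
    rw [comp_aeval_apply, map_zero] at this
    rw [← coe_aeval_eq_eval, RingHom.coe_coe, ← this]
    congr 2
    ext c
    rw [Pi.add_apply, Pi.smul_apply, smul_eq_mul, mul_comm]
    simp
  refine ⟨v, by simpa using hmem 0 hc.1 1, hv0, fun x hx a b => ?_⟩
  rw [add_comm]
  exact hmem _ (hc.2 b x hx) a

namespace IsGeneric

theorem aeval_eq_zero_iff (hp : IsGeneric X p) (i : ι) {f : MvPolynomial κ ℂ} :
    aeval (p i) f = 0 ↔ f ∈ vanishingIdeal ℂ X := by
  have h : ∀ {R : Type} [CommRing R] [Algebra ℂ R] (z : ι → κ → R),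
      aeval (uncurry z) (rename (fun c => (i, c)) f) = aeval (z i) f := fun z => by
    rw [aeval_rename]
    rfl
  rw [← h, hp]
  simp only [h]
  exact ⟨fun h x hx => h (fun _ => x) fun _ => hx, fun h P hP => h (P i) (hP i)⟩

theorem derivation_mem_tan [Fintype κ] (hp : IsGeneric X p) (i : ι) (D : Derivation ℂ K K) :
    (fun c => D (p i c)) ∈ tan X (p i) := by
  intro f hf
  have := congrArg D ((hp.aeval_eq_zero_iff i).2 hf)
  rwa [Derivation.apply_mvPolynomial_aeval, map_zero] at this

theorem mem_tan_self [Fintype κ] (hp : IsGeneric X p) (hX : IsCone X) (i : ι) : p i ∈ tan X (p i) := by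
  intro f hf
  simpa using (hp.aeval_eq_zero_iff i).2 (sum_mul_pderiv_mem hX hf)

theorem eval_eq_zero (hp : IsGeneric X p) (H : MvPolynomial (ι × κ) K)
    (hH : ∀ P : ι → κ → ℂ, (∀ i, P i ∈ X) →
      eval (uncurry fun j c => algebraMap ℂ K (P j c)) H = 0) : eval (uncurry p) H = 0 := by
  rw [eval_eq]
  refine sum_mul_eq_zero_of_forall_functional (L := ℂ) _ _ _ fun φ => ?_
  have h := (hp (∑ d ∈ H.support, monomial d (φ (coeff d H)))).2 fun P hP => ?_
  · rw [map_sum] at h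
    simpa [aeval_monomial, Finsupp.prod] using h
  · have h := congrArg φ (hH P hP)
    rw [eval_eq, map_sum, map_zero] at h
    rw [map_sum, ← h]
    refine Finset.sum_congr rfl fun d _ => ?_
    rw [aeval_monomial, mul_comm (coeff d H)]
    have : ∏ s ∈ d.support, uncurry (fun j c => algebraMap ℂ K (P j c)) s ^ d s =
        algebraMap ℂ K (∏ s ∈ d.support, uncurry P s ^ d s) := by
      simp [map_prod, uncurry]
    rw [this, ← Algebra.smul_def (A := K), map_smul, smul_eq_mul, mul_comm]
    rfl

variable [DecidableEq ι]

theorem slot_mem (hp : IsGeneric X p) {F : MvPolynomial (ι × κ) ℂ} (hF : aeval (uncurry p) F = 0)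
    (i : ι) {P : ι → κ → ℂ} (hP : ∀ j, P j ∈ X) : slot i P F ∈ vanishingIdeal ℂ X := by
  intro x hx
  rw [aeval_slot_complex]
  exact (hp F).1 hF _ (update_mem hP i hx)

theorem sum_pderiv_eq_zero [Fintype ι] [Fintype κ] (hp : IsGeneric X p) {i : ι} {v : κ → K}
    (hv : v ∈ tan X (p i)) {F : MvPolynomial (ι × κ) ℂ} (hF : aeval (uncurry p) F = 0) :
    ∑ c, aeval (uncurry p) (pderiv (i, c) F) * v c = 0 := by
  have := hp.eval_eq_zero (∑ c, fixSlot i (p i) (pderiv (i, c) F) * C (v c)) fun P hP => by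
    rw [map_sum, ← hv _ (hp.slot_mem hF i hP)]
    refine Finset.sum_congr rfl fun c _ => ?_
    rw [map_mul, eval_C, eval_fixSlot, pderiv_slot, aeval_slot]
  rw [map_sum] at this
  rw [← this]
  refine Finset.sum_congr rfl fun c _ => ?_
  rw [map_mul, eval_C, eval_fixSlot, update_eq_self]

theorem aeval_update_eq_zero (hp : IsGeneric X p) {F : MvPolynomial (ι × κ) ℂ}
    (hF : aeval (uncurry p) F = 0) (i : ι) {x : κ → ℂ} (hx : x ∈ X) :
    aeval (uncurry (update p i fun c => algebraMap ℂ K (x c))) F = 0 := by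
  rw [← aeval_fixSlot_complex, hp]
  intro P hP
  rw [aeval_fixSlot_complex]
  exact (hp F).1 hF _ (update_mem hP i hx)

end IsGeneric

variable [DecidableEq ι]

theorem exists_aeval_update_eq_of_mem_otherField {i : ι} {a : K} (ha : a ∈ otherField p i) :
    ∃ A B : MvPolynomial (ι × κ) ℂ, ∃ b : K, b ≠ 0 ∧
      ∀ z, aeval (uncurry (update p i z)) A = a * b ∧ aeval (uncurry (update p i z)) B = b := by
  have h1 : ∀ a ∈ Algebra.adjoin ℂ {a : K | ∃ j, j ≠ i ∧ ∃ c, a = p j c},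
      ∃ A : MvPolynomial (ι × κ) ℂ, ∀ z, aeval (uncurry (update p i z)) A = a := by
    intro a ha
    induction ha using Algebra.adjoin_induction with
    | mem a ha =>
      obtain ⟨j, hj, c, rfl⟩ := ha
      exact ⟨MvPolynomial.X (j, c), fun z => by simp [hj]⟩
    | algebraMap a => exact ⟨C a, fun z => by simp⟩
    | add a b _ _ ha hb =>
      obtain ⟨⟨A, hA⟩, ⟨B, hB⟩⟩ := ha, hb
      exact ⟨A + B, fun z => by rw [map_add, hA, hB]⟩
    | mul a b _ _ ha hb =>
      obtain ⟨⟨A, hA⟩, ⟨B, hB⟩⟩ := ha, hb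
      exact ⟨A * B, fun z => by rw [map_mul, hA, hB]⟩
  obtain ⟨s, hs, t, ht, rfl⟩ := (IntermediateField.mem_adjoin_iff_div).1 ha
  by_cases h0 : t = 0
  · exact ⟨0, 1, 1, one_ne_zero, fun z => by simp [h0]⟩
  · obtain ⟨⟨A, hA⟩, ⟨B, hB⟩⟩ := h1 s hs, h1 t ht
    exact ⟨A, B, t, h0, fun z => ⟨by rw [hA, div_mul_cancel₀ _ h0], hB z⟩⟩

/-- A linear relation, over the field of the other points, between polynomials in the `i`-th
generic point specializes to every point of `X`. -/
theorem IsGeneric.sum_specialize [Fintype κ] (hp : IsGeneric X p) (i : ι) (f : κ → MvPolynomial κ ℂ)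
    (v : κ → K) (hv : ∀ c, v c ∈ otherField p i) (h : ∑ c, aeval (p i) (f c) * v c = 0)
    {x : κ → ℂ} (hx : x ∈ X) : ∑ c, algebraMap ℂ K (aeval x (f c)) * v c = 0 := by
  classical
  choose A B b hb hAB using fun c => exists_aeval_update_eq_of_mem_otherField (hv c)
  let F : MvPolynomial (ι × κ) ℂ :=
    ∑ c, rename (fun d => (i, d)) (f c) * A c * ∏ d ∈ Finset.univ.erase c, B d
  have hF : ∀ z, aeval (uncurry (update p i z)) F =
      (∑ c, aeval z (f c) * v c) * ∏ c, b c := by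
    intro z
    rw [map_sum, Finset.sum_mul]
    refine Finset.sum_congr rfl fun c _ => ?_
    rw [map_mul, map_mul, map_prod, (hAB c z).1, aeval_rename,
      ← Finset.mul_prod_erase _ _ (Finset.mem_univ c)]
    have : uncurry (update p i z) ∘ (fun d => (i, d)) = z := by
      ext d
      simp
    rw [this, Finset.prod_congr rfl fun d _ => (hAB d z).2]
    ring
  have h0 := hp.aeval_update_eq_zero (F := F) (by
    rw [← update_eq_self i p, hF, h, zero_mul]) i hx
  rw [hF] at h0
  refine Eq.trans (Finset.sum_congr rfl fun c _ => ?_)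
    ((mul_eq_zero.1 h0).resolve_right (Finset.prod_ne_zero_iff.2 fun c _ => hb c))
  rw [← aeval_algebraMap_apply]
  rfl

end Tangent

section Position

open MvPolynomial Function

variable {K : Type} [Field K] [Algebra ℂ K]

theorem IsGeneric.natCast_le_finrank_tan {ι κ : Type} [Fintype κ] [Algebra.EssFiniteType ℂ K]
    {X : Set (κ → ℂ)} {p : ι → κ → K} (hp : IsGeneric X p) (hX : IsProjVar X) {n : ℕ}
    (hn : pdim X = n) (i : ι) : n + 1 ≤ Module.finrank K (tan X (p i)) := by
  have h := adim_le_of_derivations (Z := X) (p i) (fun F hF => (hp.aeval_eq_zero_iff i).1 hF)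
    (tan X (p i)) fun D => hp.derivation_mem_tan i D
  rw [pdim] at hn
  have h0 : p i ≠ 0 := by
    intro h0
    refine hX.2.2.2 (Set.eq_singleton_iff_unique_mem.2 ⟨hX.2.1.1, fun x hx => ?_⟩)
    ext c
    have : (MvPolynomial.X c : MvPolynomial κ ℂ) ∈ vanishingIdeal ℂ X :=
      (hp.aeval_eq_zero_iff i).1 (by simp [h0])
    simpa using this x hx
  have h1 : 0 < Module.finrank K (tan X (p i)) := by
    rw [Module.finrank_pos_iff_exists_ne_zero]
    exact ⟨⟨p i, hp.mem_tan_self hX.2.1 i⟩, fun h => h0 (congrArg Subtype.val h)⟩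
  rcases Nat.eq_zero_or_pos n with rfl | hn0
  · omega
  · have : ((n + 1 : ℕ) : ℕ∞) ≤ Module.finrank K (tan X (p i)) := by
      refine le_trans ?_ h
      have h1 : (1 : ℕ∞) ≤ adim X := by
        by_contra hlt
        rw [tsub_eq_zero_of_le (not_le.1 hlt).le] at hn
        exact hn0.ne (by exact_mod_cast hn)
      rw [Nat.cast_add, ← hn, Nat.cast_one, tsub_add_cancel_of_le h1]
    exact_mod_cast this

variable {r k : ℕ} {X : Set (Fin (r + 1) → ℂ)} {p : Fin (k + 2) → Fin (r + 1) → K}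

theorem IsGeneric.iSup_tan_ne_top (hp : IsGeneric X p) (hS : Sec X k ≠ Set.univ)
    (m : Fin (k + 2)) : ⨆ i, ⨆ _ : i ≠ m, tan X (p i) ≠ ⊤ := by
  classical
  intro htop
  have hsum : (⨆ i, ⨆ _ : i ≠ m, tan X (p i)) =
      ⨆ i, if i ≠ m then tan X (p i) else ⊥ := by
    refine iSup_congr fun i => ?_
    by_cases h : i ≠ m <;> simp [h]
  have hw : ∀ a : Fin (r + 1), ∃ w : Fin (k + 2) → Fin (r + 1) → K,
      (∀ i, w i ∈ tan X (p i)) ∧ w m = 0 ∧ ∑ i, w i = Pi.single a 1 := by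
    intro a
    have ha : (Pi.single a 1 : Fin (r + 1) → K) ∈ ⨆ i, if i ≠ m then tan X (p i) else ⊥ := by
      rw [← hsum, htop]
      exact mem_top
    obtain ⟨w, hw, hwa⟩ := (mem_iSup_iff_exists_finsupp _ _).1 ha
    refine ⟨w, fun i => ?_, ?_, ?_⟩
    · have := hw i
      by_cases h : i ≠ m
      · simpa [h] using this
      · simp only [h, if_false, mem_bot] at this
        rw [this]
        exact zero_mem _
    · simpa using hw m
    · rw [← hwa, Finsupp.sum_fintype _ _ fun _ => rfl]
  choose w hwT hwm hwa using hw
  have hind : AlgebraicIndependent ℂ fun c : Fin (r + 1) => aeval (uncurry p)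
      (∑ i ∈ Finset.univ.erase m, MvPolynomial.X (i, c) : MvPolynomial (Fin (k + 2) × Fin (r + 1)) ℂ) := by
    refine algebraicIndependent_of_det_ne_zero _ _ (fun a => uncurry (w a)) (fun a F hF => ?_) ?_
    · rw [Fintype.sum_prod_type]
      exact Finset.sum_eq_zero fun i _ => hp.sum_pderiv_eq_zero (hwT a i) hF
    · convert one_ne_zero (α := K)
      convert Matrix.det_one (n := Fin (r + 1)) (R := K)
      ext a b
      have : ∀ i c, aeval (uncurry p) (pderiv (i, c) (∑ i ∈ Finset.univ.erase m,
          MvPolynomial.X (i, b) : MvPolynomial (Fin (k + 2) × Fin (r + 1)) ℂ)) * w a i c =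
          if c = b then w a i b else 0 := by
        intro i c
        by_cases hi : i = m
        · subst hi
          simp [hwm]
        · by_cases hc : c = b
          · subst hc
            rw [map_sum, Finset.sum_eq_single i]
            · simp
            · intro j _ hj
              rw [pderiv_X, Pi.single_eq_of_ne]
              simpa using hj
            · simp [hi]
          · rw [map_sum, Finset.sum_eq_zero]
            · simp [hc]
            · intro j _
              rw [pderiv_X, Pi.single_eq_of_ne]
              simp [Ne.symm hc]
      rw [Matrix.of_apply, Fintype.sum_prod_type]
      simp only [uncurry_apply_pair, this, Finset.sum_ite_eq', Finset.mem_univ, if_true]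
      have := congrFun (hwa a) b
      rw [Finset.sum_apply] at this
      rw [this, Matrix.one_apply, Pi.single_apply]
      simp only [eq_comm]
  refine hS (Set.eq_univ_of_forall fun y => mem_zcl_iff.2 fun F hF => ?_)
  suffices F = 0 by simp [this]
  refine (injective_iff_map_eq_zero _).1 hind F ?_
  rw [← comp_aeval_apply, hp]
  intro P hP
  rw [comp_aeval_apply]
  refine hF _ (Set.mem_biUnion (x := fun i => P (m.succAbove i)) (fun i => hP _) ?_)
  have : (fun c => aeval (uncurry P) (∑ i ∈ Finset.univ.erase m, MvPolynomial.X (i, c) :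
      MvPolynomial (Fin (k + 2) × Fin (r + 1)) ℂ)) = ∑ i, P (m.succAbove i) := by
    ext c
    rw [map_sum, Finset.sum_apply]
    simp only [aeval_X, uncurry_apply_pair]
    have h1 := Fin.sum_univ_succAbove (fun i => P i c) m
    have h2 := Finset.add_sum_erase Finset.univ (fun i => P i c) (Finset.mem_univ m)
    exact add_left_cancel (h2.trans h1)
  rw [this]
  exact sum_mem fun i _ => subset_span ⟨i, rfl⟩

/-- The `m`-th generic point lies outside the span of the tangent spaces at the other ones. -/
theorem IsGeneric.notMem_iSup_tan (hp : IsGeneric X p) (hnd : Nondeg X)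
    (hS : Sec X k ≠ Set.univ) (m : Fin (k + 2)) : p m ∉ ⨆ i, ⨆ _ : i ≠ m, tan X (p i) := by
  intro hpm
  let S : Set (Fin (r + 1) → otherField p m) :=
    {u | ∃ i, i ≠ m ∧ (fun c => algebraMap (otherField p m) K (u c)) ∈ tan X (p i)}
  have hle : ⨆ i, ⨆ _ : i ≠ m, tan X (p i) = span K
      ((fun (u : Fin (r + 1) → otherField p m) c => algebraMap (otherField p m) K (u c)) '' S) := by
    refine le_antisymm (iSup₂_le fun i hi => (tan_le_span_otherField X hi).trans (span_mono ?_))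
      (span_le.2 ?_)
    · exact Set.image_mono fun u hu => ⟨i, hi, hu⟩
    · rintro _ ⟨u, ⟨i, hi, hu⟩, rfl⟩
      exact mem_iSup_of_mem i (mem_iSup_of_mem hi hu)
  obtain ⟨θ, hθ0, hθ⟩ := exists_functional_of_span_ne_top (hle ▸ hp.iSup_tan_ne_top hS m)
  have h0 := hθ (p m) (hle ▸ hpm)
  have hX : ∀ x ∈ X, ∑ c, algebraMap ℂ K (x c) * (θ c : K) = 0 := fun x hx => by
    have := hp.sum_specialize m MvPolynomial.X (fun c => (θ c : K)) (fun c => (θ c).2)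
      (by simpa [mul_comm] using h0) hx
    simpa using this
  obtain ⟨c, hc⟩ := Function.ne_iff.1 hθ0
  refine hc ?_
  rw [Pi.zero_apply, ← ZeroMemClass.coe_eq_zero, ← Module.forall_dual_apply_eq_zero_iff ℂ]
  intro φ
  let ℓ : (Fin (r + 1) → ℂ) →ₗ[ℂ] ℂ := ∑ c, φ (θ c : K) • LinearMap.proj c
  have hℓ : ∀ x : Fin (r + 1) → ℂ, x ∈ span ℂ X → ℓ x = 0 := by
    intro x hx
    induction hx using span_induction with
    | mem x hx =>
      have := congrArg φ (hX x hx)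
      rw [map_sum, map_zero] at this
      rw [← this, LinearMap.sum_apply]
      refine Finset.sum_congr rfl fun c _ => ?_
      rw [← Algebra.smul_def, map_smul, LinearMap.smul_apply, LinearMap.proj_apply, smul_eq_mul,
        smul_eq_mul, mul_comm]
    | zero => exact map_zero _
    | add x y _ _ hx hy => rw [map_add, hx, hy, add_zero]
    | smul a x _ hx => rw [map_smul, hx, smul_zero]
  have := hℓ (Pi.single c 1) (by rw [show span ℂ X = ⊤ from hnd]; exact mem_top)
  simpa [ℓ, Pi.single_apply] using this

end Position

section LinearPosition

variable {K V ι : Type*} [Field K] [AddCommGroup V] [Module K V]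
  {T : ι → Submodule K V} {p : ι → V}

/-- Each vector lies in its own subspace but not in the span of the other subspaces. -/
structure InGeneralPosition (T : ι → Submodule K V) (p : ι → V) : Prop where
  mem : ∀ i, p i ∈ T i
  notMem : ∀ m, p m ∉ ⨆ i, ⨆ _ : i ≠ m, T i

namespace InGeneralPosition

theorem le_iSup {i m : ι} (hi : i ≠ m) : T i ≤ ⨆ i, ⨆ _ : i ≠ m, T i :=
  le_iSup₂_of_le i hi le_rfl

variable [Fintype ι]

theorem coeff_eq_zero (h : InGeneralPosition T p) {c : ι → K} {m : ι}
    (hc : ∑ i, c i • p i ∈ ⨆ i, ⨆ _ : i ≠ m, T i) : c m = 0 := by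
  classical
  by_contra h0
  refine h.notMem m ((smul_mem_iff _ h0).1 ?_)
  rw [← Finset.add_sum_erase _ _ (Finset.mem_univ m)] at hc
  refine (add_mem_cancel_right ?_).1 hc
  refine sum_mem fun i hi => smul_mem _ _ ?_
  exact mem_iSup_of_mem i (mem_iSup_of_mem (Finset.ne_of_mem_erase hi) (h.mem i))

theorem linearIndependent (h : InGeneralPosition T p) : LinearIndependent K p :=
  Fintype.linearIndependent_iff.2 fun _ hc _ => h.coeff_eq_zero (hc ▸ zero_mem _)

theorem exists_sum_eq {v w : V} (h : (span K (Set.range p)).mkQ v = (span K (Set.range p)).mkQ w) :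
    ∃ c : ι → K, v - w = ∑ i, c i • p i := by
  rw [mkQ_apply, mkQ_apply, Submodule.Quotient.eq, mem_span_range_iff_exists_fun] at h
  obtain ⟨c, hc⟩ := h
  exact ⟨c, hc.symm⟩

theorem inf_span_eq (h : InGeneralPosition T p) (i : ι) :
    T i ⊓ span K (Set.range p) = span K {p i} := by
  classical
  refine le_antisymm (fun v hv => ?_) ?_
  · obtain ⟨c, rfl⟩ := (mem_span_range_iff_exists_fun K).1 hv.2
    have hc : ∀ m, m ≠ i → c m = 0 := fun m hm =>
      h.coeff_eq_zero (le_iSup hm.symm hv.1)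
    rw [Finset.sum_eq_single i (fun m _ hm => by rw [hc m hm, zero_smul]) (by simp)]
    exact smul_mem _ _ (mem_span_singleton_self _)
  · rw [span_singleton_le_iff_mem]
    exact ⟨h.mem i, subset_span ⟨i, rfl⟩⟩

theorem finrank_map_mkQ [FiniteDimensional K V] (h : InGeneralPosition T p) (i : ι) :
    Module.finrank K ((T i).map (span K (Set.range p)).mkQ) + 1 = Module.finrank K (T i) := by
  have h1 := ((span K (Set.range p)).mkQ.domRestrict (T i)).finrank_range_add_finrank_ker
  rw [LinearMap.range_domRestrict] at h1
  rw [← h1]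
  congr 1
  have : ((span K (Set.range p)).mkQ.domRestrict (T i)).ker.map (T i).subtype =
      span K {p i} := by
    rw [← h.inf_span_eq, LinearMap.ker_domRestrict, Submodule.map_comap_subtype, ker_mkQ]
  rw [← finrank_map_subtype_eq, this, finrank_span_singleton (h.linearIndependent.ne_zero i)]

theorem exists_lift (h : InGeneralPosition T p) {J : Finset ι} {j₁ : ι}
    (hj₁ : j₁ ∈ J) {u : V ⧸ span K (Set.range p)}
    (hu : ∀ j ∈ J, u ∈ (T j).map (span K (Set.range p)).mkQ) :
    ∃ v, (span K (Set.range p)).mkQ v = u ∧ ∀ j ∈ J, v ∈ T j := by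
  classical
  choose! v hvT hvu using hu
  by_cases hJ : ∃ j₂ ∈ J, j₂ ≠ j₁
  · obtain ⟨j₂, hj₂, hne⟩ := hJ
    have hc : ∀ j, ∃ c : ι → K, j ∈ J → v j₁ - v j = ∑ i, c i • p i := fun j => by
      by_cases hj : j ∈ J
      · obtain ⟨c, hc⟩ := exists_sum_eq ((hvu j₁ hj₁).trans (hvu j hj).symm)
        exact ⟨c, fun _ => hc⟩
      · exact ⟨0, fun h => absurd h hj⟩
    choose c hc using hc
    have hc0 : ∀ j ∈ J, ∀ m, m ≠ j₁ → m ≠ j → c j m = 0 := fun j hj m hm hm' => by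
      refine h.coeff_eq_zero (hc j hj ▸ sub_mem ?_ ?_)
      · exact le_iSup hm.symm (hvT j₁ hj₁)
      · exact le_iSup hm'.symm (hvT j hj)
    have hca : ∀ j ∈ J, j ≠ j₁ → c j j₁ = c j₂ j₁ := fun j hj hjj => by
      have : (c j - c j₂) j₁ = 0 := by
        refine h.coeff_eq_zero ?_
        have : ∑ i, (c j - c j₂) i • p i = v j₂ - v j := by
          simp only [Pi.sub_apply, sub_smul, Finset.sum_sub_distrib]
          rw [← hc j hj, ← hc j₂ hj₂]
          abel
        rw [this]
        exact sub_mem (le_iSup hne (hvT _ hj₂)) (le_iSup hjj (hvT _ hj))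
      exact sub_eq_zero.1 this
    refine ⟨v j₁ - c j₂ j₁ • p j₁, ?_, fun j hj => ?_⟩
    · have hp : p j₁ ∈ span K (Set.range p) := subset_span ⟨j₁, rfl⟩
      rw [map_sub, hvu j₁ hj₁, map_smul, mkQ_apply _ (p j₁),
        (Submodule.Quotient.mk_eq_zero _).2 hp, smul_zero, sub_zero]
    · by_cases hjj : j = j₁
      · subst hjj
        exact sub_mem (hvT _ hj) (smul_mem _ _ (h.mem _))
      · have h1 : v j₁ = v j + (c j₂ j₁ • p j₁ + c j j • p j) := by
          rw [← sub_eq_iff_eq_add', hc j hj, ← hca j hj hjj]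
          refine Finset.sum_eq_add_of_mem _ _ (Finset.mem_univ _) (Finset.mem_univ _)
            (Ne.symm hjj) fun m _ hm => ?_
          rw [hc0 j hj m hm.1 hm.2, zero_smul]
        rw [h1, ← add_assoc, add_right_comm, add_sub_cancel_right]
        exact add_mem (hvT j hj) (smul_mem _ _ (h.mem j))
  · push Not at hJ
    exact ⟨v j₁, hvu j₁ hj₁, fun j hj => (hJ j hj).symm ▸ hvT j₁ hj₁⟩

theorem mem_of_mkQ_mem (h : InGeneralPosition T p) {i j₁ j₂ : ι} (h₁₂ : j₁ ≠ j₂) {v : V} (hv₁ : v ∈ T j₁) (hv₂ : v ∈ T j₂)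
    (hv : (span K (Set.range p)).mkQ v ∈ (T i).map (span K (Set.range p)).mkQ) : v ∈ T i := by
  classical
  obtain ⟨t, ht, htv⟩ := hv
  obtain ⟨c, hc⟩ := exists_sum_eq htv.symm
  have hc0 : ∀ m, m ≠ i → c m = 0 := fun m hm => by
    refine h.coeff_eq_zero (hc ▸ sub_mem ?_ (le_iSup hm.symm ht))
    by_cases hm₁ : m = j₁
    · exact le_iSup (hm₁ ▸ h₁₂.symm) hv₂
    · exact le_iSup (Ne.symm hm₁) hv₁
  rw [Finset.sum_eq_single i (fun m _ hm => by rw [hc0 m hm, zero_smul]) (by simp),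
    sub_eq_iff_eq_add] at hc
  rw [hc]
  exact add_mem (smul_mem _ _ (h.mem i)) ht

end InGeneralPosition

end LinearPosition

section NoCone

open MvPolynomial

variable {ι κ K : Type} [Fintype ι] [Fintype κ] [Field K] [Algebra ℂ K]
  {X : Set (κ → ℂ)} {p : ι → κ → K}

/-- If a direction common to at least two of the tangent spaces, taken modulo the generic points,
is always a direction of one more tangent space, then `X` is a cone. -/
theorem IsGeneric.isConeVar (hp : IsGeneric X p) (hX : IsProjVar X)
    (hpos : InGeneralPosition (fun i => tan X (p i)) p) {J : Finset ι} {i j₁ j₂ : ι}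
    (hi : i ∉ J) (hj₁ : j₁ ∈ J) (hj₂ : j₂ ∈ J) (hne : j₁ ≠ j₂)
    {u : (κ → K) ⧸ span K (Set.range p)} (hu0 : u ≠ 0)
    (hu : ∀ j ∈ J, u ∈ (tan X (p j)).map (span K (Set.range p)).mkQ)
    (hJi : ∀ u', (∀ j ∈ J, u' ∈ (tan X (p j)).map (span K (Set.range p)).mkQ) →
      u' ∈ (tan X (p i)).map (span K (Set.range p)).mkQ) : IsConeVar X := by
  classical
  have hji : ∀ j ∈ J, j ≠ i := fun j hj h => hi (h ▸ hj)
  obtain ⟨v, rfl, hv⟩ := hpos.exists_lift hj₁ hu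
  let S : Set (κ → otherField p i) := {s | ∃ j, ∃ hj : j ≠ i, j ∈ J ∧
    ∃ f ∈ vanishingIdeal ℂ X, s = fun c => ⟨aeval (p j) (pderiv c f), aeval_mem_otherField hj _⟩}
  obtain ⟨w, hw0, hw⟩ := exists_ne_zero_solution S (v := v)
    (fun h => hu0 (by rw [h, map_zero])) (by
      rintro _ ⟨j, hj, hjJ, f, hf, rfl⟩
      exact hv j hjJ f hf)
  have hwJ : ∀ j ∈ J, (fun c => (w c : K)) ∈ tan X (p j) := fun j hj f hf => by
    simpa using congrArg (algebraMap (otherField p i) K) (hw _ ⟨j, hji j hj, hj, f, hf, rfl⟩)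
  have hwi : (fun c => (w c : K)) ∈ tan X (p i) :=
    hpos.mem_of_mkQ_mem hne (hwJ _ hj₁) (hwJ _ hj₂)
      (hJi _ fun j hj => mem_map_of_mem (hwJ j hj))
  obtain ⟨c, hc⟩ := Function.ne_iff.1 hw0
  have hc' : (w c : K) ≠ 0 := fun h => hc (Subtype.ext h)
  obtain ⟨φ, hφ⟩ : ∃ φ : Module.Dual ℂ K, φ (w c) ≠ 0 := by
    by_contra! h
    exact hc' ((Module.forall_dual_apply_eq_zero_iff ℂ _).1 h)
  refine IsConeVar.of_forall_pderiv hX.1 hX.2.1 (v := fun c => φ (w c))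
    (Function.ne_iff.2 ⟨c, hφ⟩) fun f hf x hx => ?_
  have h := congrArg φ (hp.sum_specialize i (fun c => pderiv c f) (fun c => (w c : K))
    (fun c => (w c).2) (hwi f hf) hx)
  simpa [← Algebra.smul_def] using h

end NoCone

section Syzygies

open Module

variable {K Q ι : Type*} [Field K] [AddCommGroup Q] [Module K Q] [Fintype ι]
  (τ : ι → Submodule K Q)

/-- The weighted sum of a family of vectors of given subspaces. -/
def weightedSum (w : ι → K) : (∀ i, τ i) →ₗ[K] Q :=
  ∑ i, w i • (τ i).subtype ∘ₗ LinearMap.proj i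

theorem weightedSum_apply (w : ι → K) (t : ∀ i, τ i) :
    weightedSum τ w t = ∑ i, w i • (t i : Q) := by
  simp [weightedSum]

/-- The families of vectors of given subspaces all of whose weighted sums, with weights in `U`,
vanish. -/
def syz (U : Submodule K (ι → K)) : Submodule K (∀ i, τ i) :=
  ⨅ w : U, (weightedSum τ w).ker

variable {τ}

theorem mem_syz {U : Submodule K (ι → K)} {t : ∀ i, τ i} :
    t ∈ syz τ U ↔ ∀ w ∈ U, ∑ i, w i • (t i : Q) = 0 := by
  simp [syz, weightedSum_apply]

theorem syz_anti {U U' : Submodule K (ι → K)} (h : U ≤ U') : syz τ U' ≤ syz τ U :=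
  fun _ ht => mem_syz.2 fun w hw => mem_syz.1 ht w (h hw)

theorem mem_syz_sup_span {U : Submodule K (ι → K)} {w : ι → K} {t : ∀ i, τ i} :
    t ∈ syz τ (U ⊔ span K {w}) ↔ t ∈ syz τ U ∧ weightedSum τ w t = 0 := by
  rw [weightedSum_apply]
  constructor
  · intro h
    exact ⟨syz_anti le_sup_left h, mem_syz.1 h w (mem_sup_right (mem_span_singleton_self w))⟩
  · rintro ⟨h, hw⟩
    refine mem_syz.2 fun y hy => ?_
    obtain ⟨y, hy', z, hz, rfl⟩ := mem_sup.1 hy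
    obtain ⟨c, rfl⟩ := mem_span_singleton.1 hz
    simp only [Pi.add_apply, Pi.smul_apply, smul_eq_mul, add_smul, mul_smul,
      Finset.sum_add_distrib]
    rw [mem_syz.1 h y hy', ← Finset.smul_sum, hw, smul_zero, add_zero]

theorem exists_le_finrank_eq {V : Type*} [AddCommGroup V] [Module K V] [FiniteDimensional K V]
    (U : Submodule K V) {d : ℕ} (h₁ : finrank K U ≤ d) (h₂ : d ≤ finrank K V) :
    ∃ U', U ≤ U' ∧ finrank K U' = d := by
  obtain ⟨e, rfl⟩ := Nat.exists_eq_add_of_le h₁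
  induction e with
  | zero => exact ⟨U, le_rfl, rfl⟩
  | succ e ih =>
    obtain ⟨U', hU', hd⟩ := ih (Nat.le_add_right _ _) (by omega)
    have hlt : U' ≠ ⊤ := by
      rintro rfl
      rw [finrank_top] at hd
      omega
    obtain ⟨v, -, hv⟩ := SetLike.exists_of_lt (lt_top_iff_ne_top.2 hlt)
    exact ⟨U' ⊔ span K {v}, hU'.trans le_sup_left, by
      rw [finrank_sup_span_singleton hv, hd]; omega⟩

theorem mem_span_of_finrank_map_le_one {M : Type*} [AddCommGroup M] [Module K M]
    [FiniteDimensional K M] (φ : M →ₗ[K] Q) {N : Submodule K M} (h : finrank K (N.map φ) ≤ 1)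
    {s t : M} (hs : s ∈ N) (ht : t ∈ N) (h0 : φ t ≠ 0) : φ s ∈ span K {φ t} := by
  obtain ⟨v, hv⟩ := finrank_le_one_iff.1 h
  obtain ⟨a, ha⟩ := hv ⟨φ s, mem_map_of_mem hs⟩
  obtain ⟨b, hb⟩ := hv ⟨φ t, mem_map_of_mem ht⟩
  have ha : a • (v : Q) = φ s := congrArg Subtype.val ha
  have hb : b • (v : Q) = φ t := congrArg Subtype.val hb
  have hb0 : b ≠ 0 := by
    rintro rfl
    exact h0 (by rw [← hb, zero_smul])
  refine mem_span_singleton.2 ⟨a * b⁻¹, ?_⟩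
  rw [← hb, ← ha, mul_smul, inv_smul_smul₀ hb0]

theorem exists_two_le_finrank_map_weightedSum [FiniteDimensional K Q] {U : Submodule K (ι → K)}
    (h1 : 1 ∈ U) (hU : ∀ w, syz τ (U ⊔ span K {w}) ≠ ⊥)
    (hτ : ∀ (J : Finset ι) (i j₁ j₂ : ι) (u : Q), i ∉ J → j₁ ∈ J → j₂ ∈ J → j₁ ≠ j₂ → u ≠ 0 →
      (∀ j ∈ J, u ∈ τ j) → ¬ ∀ u', (∀ j ∈ J, u' ∈ τ j) → u' ∈ τ i) :
    ∃ w, 2 ≤ finrank K ((syz τ U).map (weightedSum τ w)) := by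
  classical
  by_contra! hlt
  have hrk : ∀ w : ι → K, ∀ s ∈ syz τ U, ∀ t ∈ syz τ U, ∑ i, w i • (t i : Q) ≠ 0 →
      ∑ i, w i • (s i : Q) ∈ span K {∑ i, w i • (t i : Q)} := by
    intro w s hs t ht h0
    simp only [← weightedSum_apply] at h0 ⊢
    exact mem_span_of_finrank_map_le_one _ (Nat.le_of_lt_succ (hlt w)) hs ht h0
  have hrk1 : ∀ i, ∀ s ∈ syz τ U, ∀ t ∈ syz τ U, (t i : Q) ≠ 0 → (s i : Q) ∈ span K {(t i : Q)} := by
    intro i s hs t ht h0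
    simpa [Pi.single_apply, ite_smul] using hrk (Pi.single i 1) s hs t ht
      (by simpa [Pi.single_apply, ite_smul] using h0)
  obtain ⟨w, hw, hw0⟩ := (Submodule.ne_bot_iff _).1 (hU 0)
  replace hw := (mem_syz_sup_span.1 hw).1
  obtain ⟨i, hi⟩ := Function.ne_iff.1 hw0
  have hi : (w i : Q) ≠ 0 := fun h => hi (Subtype.ext h)
  obtain ⟨t, ht, ht0⟩ := (Submodule.ne_bot_iff _).1 (hU (Pi.single i 1))
  obtain ⟨ht, hti⟩ := mem_syz_sup_span.1 ht
  have hti : (t i : Q) = 0 := by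
    simpa [weightedSum_apply, Pi.single_apply, ite_smul] using hti
  have hmul : ∀ j, ∃ a : K, (t j : Q) = a • (w i : Q) := by
    intro j
    by_cases hj : (t j : Q) = 0
    · exact ⟨0, by rw [hj, zero_smul]⟩
    have hij : j ≠ i := fun h => hj (h ▸ hti)
    obtain ⟨b, hb⟩ := mem_span_singleton.1 (hrk1 j w hw t ht hj)
    have hsum : ∀ s : ∀ i, τ i, ∑ l, (Pi.single i 1 + Pi.single j 1 : ι → K) l • (s l : Q) =
        s i + s j := fun s => by
      simp [add_smul, Finset.sum_add_distrib, Pi.single_apply, ite_smul]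
    have h := hrk (Pi.single i 1 + Pi.single j 1) w hw t ht
    rw [hsum, hsum, hti, zero_add] at h
    obtain ⟨c, hc⟩ := mem_span_singleton.1 (h hj)
    have hcb : (c - b) • (t j : Q) = w i := by rw [sub_smul, hc, hb, add_sub_cancel_right]
    have hcb0 : c - b ≠ 0 := fun h => hi (by rw [← hcb, h, zero_smul])
    exact ⟨(c - b)⁻¹, by rw [← hcb, inv_smul_smul₀ hcb0]⟩
  choose a ha using hmul
  have hwt : ∀ y : ι → K, y ∈ U → ∑ j, y j * a j = 0 := by
    intro y hy
    have h := mem_syz.1 ht y hy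
    simp only [ha, smul_smul] at h
    rw [← Finset.sum_smul] at h
    exact (smul_eq_zero.1 h).resolve_right hi
  have hai : a i = 0 := (smul_eq_zero.1 ((ha i).symm.trans hti)).resolve_right hi
  obtain ⟨j₁, hj₁⟩ : ∃ j, a j ≠ 0 := by
    by_contra! h
    exact ht0 (funext fun j => Subtype.ext (by rw [ha, h, zero_smul]; rfl))
  obtain ⟨j₂, hj₂, hne⟩ : ∃ j, a j ≠ 0 ∧ j₁ ≠ j := by
    by_contra! h
    have := hwt 1 h1
    rw [Finset.sum_eq_single j₁ (fun j _ hj => ?_) (by simp)] at this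
    · exact hj₁ (by simpa using this)
    · rw [Pi.one_apply, one_mul]
      by_contra h0
      exact hj (h j h0).symm
  refine hτ {j | a j ≠ 0} i j₁ j₂ (w i) (by simpa using hai) (by simpa using hj₁)
    (by simpa using hj₂) hne hi (fun j hj => ?_) fun u' hu' => ?_
  · have hj : a j ≠ 0 := by simpa using hj
    have := (t j).2
    rw [ha] at this
    exact (smul_mem_iff _ hj).1 this
  · have hmem : ∀ j, a j • u' ∈ τ j := fun j => by
      by_cases hj : a j = 0
      · rw [hj, zero_smul]
        exact zero_mem _
      · exact smul_mem _ _ (hu' j (by simpa using hj))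
    have hs : (fun j => ⟨a j • u', hmem j⟩ : ∀ j, τ j) ∈ syz τ U := mem_syz.2 fun y hy => by
      simp only [smul_smul]
      rw [← Finset.sum_smul, hwt y hy, zero_smul]
    have h0 : (t j₁ : Q) ≠ 0 := by
      rw [ha]
      exact smul_ne_zero hj₁ hi
    obtain ⟨c, hc⟩ := mem_span_singleton.1 (hrk1 j₁ _ hs t ht h0)
    have : a j₁ • u' ∈ τ i := by
      change c • (t j₁ : Q) = a j₁ • u' at hc
      rw [← hc, ha]
      exact smul_mem _ _ (smul_mem _ _ (w i).2)
    exact (smul_mem_iff _ hj₁).1 this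

theorem exists_finrank_syz_add_le [FiniteDimensional K Q] {h : ℕ} (hh : h + 1 ≤ Fintype.card ι)
    (hU : ∀ U : Submodule K (ι → K), finrank K U = h + 1 → syz τ U ≠ ⊥)
    (hτ : ∀ (J : Finset ι) (i j₁ j₂ : ι) (u : Q), i ∉ J → j₁ ∈ J → j₂ ∈ J → j₁ ≠ j₂ → u ≠ 0 →
      (∀ j ∈ J, u ∈ τ j) → ¬ ∀ u', (∀ j ∈ J, u' ∈ τ j) → u' ∈ τ i) :
    ∃ U : Submodule K (ι → K), finrank K U = h + 1 ∧
      finrank K (syz τ U) + 2 * h ≤ finrank K (syz τ (span K {1})) := by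
  suffices ∀ j ≤ h, ∃ U : Submodule K (ι → K), 1 ∈ U ∧ finrank K U = j + 1 ∧
      finrank K (syz τ U) + 2 * j ≤ finrank K (syz τ (span K {1})) by
    obtain ⟨U, -, h⟩ := this h le_rfl
    exact ⟨U, h⟩
  intro j
  induction j with
  | zero =>
    intro _
    have : Nonempty ι := Fintype.card_pos_iff.1 (by omega)
    exact ⟨span K {1}, mem_span_singleton_self 1, finrank_span_singleton one_ne_zero, le_rfl⟩
  | succ j ih =>
    intro hj
    obtain ⟨U, h1, hd, hle⟩ := ih (by omega)
    obtain ⟨w, hw⟩ := exists_two_le_finrank_map_weightedSum (τ := τ) h1 (fun w => by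
      obtain ⟨U', hU', hd'⟩ := exists_le_finrank_eq (U ⊔ span K {w}) (d := h + 1)
        ((finrank_add_le_finrank_add_finrank _ _).trans
          (by
            have := finrank_span_le_card (R := K) {w}
            rw [Set.toFinset_singleton, Finset.card_singleton] at this
            omega)) (by simpa using hh)
      exact ne_bot_of_le_ne_bot (hU U' hd') (syz_anti hU')) hτ
    have hwU : w ∉ U := fun hwU => by
      have : (syz τ U).map (weightedSum τ w) = ⊥ := by
        rw [eq_bot_iff, Submodule.map_le_iff_le_comap]
        intro t ht
        rw [mem_comap, mem_bot, weightedSum_apply]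
        exact mem_syz.1 ht w hwU
      rw [this, finrank_bot] at hw
      omega
    refine ⟨U ⊔ span K {w}, mem_sup_left h1, by rw [finrank_sup_span_singleton hwU, hd], ?_⟩
    have hrn := ((weightedSum τ w).domRestrict (syz τ U)).finrank_range_add_finrank_ker
    have hker : ((weightedSum τ w).domRestrict (syz τ U)).ker.map (syz τ U).subtype =
        syz τ (U ⊔ span K {w}) := by
      rw [LinearMap.ker_domRestrict, Submodule.map_comap_subtype]
      ext t
      rw [mem_syz_sup_span]
      rfl
    rw [LinearMap.range_domRestrict, ← finrank_map_subtype_eq, hker] at hrn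
    omega

end Syzygies

section SecantBound

open MvPolynomial Function

theorem range_weightedSum_one {K Q ι : Type*} [Field K] [AddCommGroup Q] [Module K Q] [Fintype ι]
    (τ : ι → Submodule K Q) : (weightedSum τ 1).range = ⨆ i, τ i := by
  classical
  refine le_antisymm ?_ (iSup_le fun i v hv => ?_)
  · rintro _ ⟨t, rfl⟩
    rw [weightedSum_apply]
    exact sum_mem fun i _ => smul_mem _ _ (mem_iSup_of_mem i (t i).2)
  · refine ⟨Pi.single i ⟨v, hv⟩, ?_⟩
    rw [weightedSum_apply, Finset.sum_eq_single i]
    · simp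
    · intro j _ hj
      simp [hj]
    · simp

theorem syz_span_one {K Q ι : Type*} [Field K] [AddCommGroup Q] [Module K Q] [Fintype ι]
    (τ : ι → Submodule K Q) : syz τ (span K {1}) = (weightedSum τ 1).ker := by
  ext t
  rw [LinearMap.mem_ker, weightedSum_apply, mem_syz]
  refine ⟨fun h => h 1 (mem_span_singleton_self 1), fun h w hw => ?_⟩
  obtain ⟨c, rfl⟩ := mem_span_singleton.1 hw
  simp only [Pi.smul_apply, smul_assoc]
  rw [← Finset.smul_sum, h, smul_zero]

theorem InGeneralPosition.finrank_iSup_add {K V ι : Type*} [Field K] [AddCommGroup V] [Module K V]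
    [FiniteDimensional K V] [Fintype ι] {T : ι → Submodule K V} {p : ι → V}
    (h : InGeneralPosition T p) :
    Module.finrank K ↥(⨆ i, T i) + Module.finrank K
      (syz (fun i => (T i).map (span K (Set.range p)).mkQ) (span K {1})) =
    Fintype.card ι + ∑ i, Module.finrank K ((T i).map (span K (Set.range p)).mkQ) := by
  have h1 := (weightedSum (fun i => (T i).map (span K (Set.range p)).mkQ)
    1).finrank_range_add_finrank_ker
  rw [range_weightedSum_one, ← syz_span_one, ← Submodule.map_iSup, Module.finrank_pi_fintype] at h1
  have h2 := ((span K (Set.range p)).mkQ.domRestrict (⨆ i, T i)).finrank_range_add_finrank_ker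
  have hle : span K (Set.range p) ≤ ⨆ i, T i := by
    rw [span_le]
    rintro _ ⟨i, rfl⟩
    exact mem_iSup_of_mem i (h.mem i)
  have hker : ((span K (Set.range p)).mkQ.domRestrict (⨆ i, T i)).ker.map (⨆ i, T i).subtype =
      span K (Set.range p) := by
    rw [LinearMap.ker_domRestrict, Submodule.map_comap_subtype, ker_mkQ, inf_eq_right.2 hle]
  rw [LinearMap.range_domRestrict, ← finrank_map_subtype_eq, hker,
    finrank_span_eq_card h.linearIndependent] at h2
  omega

theorem IsGeneric.adim_sec_le {κ K : Type} [Fintype κ] [Field K] [Algebra ℂ K]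
    [Algebra.EssFiniteType ℂ K] {X : Set (κ → ℂ)} {k : ℕ} {p : Fin (k + 1) → κ → K}
    (hp : IsGeneric X p) (hX : IsCone X) :
    adim (Sec X k) ≤ Module.finrank K ↥(⨆ i, tan X (p i)) := by
  refine adim_le_of_derivations (fun c => ∑ i, p i c) (fun F hF => ?_) _ fun D => ?_
  · rw [Sec, vanishingIdeal_zcl]
    let s (c : κ) : MvPolynomial (Fin (k + 1) × κ) ℂ := ∑ i, MvPolynomial.X (i, c)
    have hs : ∀ {R : Type} [CommRing R] [Algebra ℂ R] (z : Fin (k + 1) → κ → R),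
        aeval (uncurry z) (aeval s F) = aeval (fun c => ∑ i, z i c) F := fun z => by
      rw [comp_aeval_apply]
      simp [s]
    rw [← hs, hp] at hF
    intro y hy
    obtain ⟨P, hP, hy⟩ := Set.mem_iUnion₂.1 hy
    obtain ⟨a, rfl⟩ := (mem_span_range_iff_exists_fun ℂ).1 hy
    rw [← hF (fun i => a i • P i) fun i => hX.2 _ _ (hP i), hs]
    congr 2
    ext c
    simp
  · have : (fun c => D (∑ i, p i c)) = ∑ i, fun c => D (p i c) := by
      ext c
      simp
    rw [this]
    exact sum_mem fun i _ => mem_iSup_of_mem i (hp.derivation_mem_tan i D)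

end SecantBound

section Minors

open Module

theorem LinearMap.exists_det_eq_one {K E S : Type*} [Field K] [AddCommGroup E] [Module K E]
    [Finite S] (Ψ : E →ₗ[K] S → K) :
    ∃ (e : Fin (finrank K Ψ.range) → E) (s : Fin (finrank K Ψ.range) → S),
      (Matrix.of fun a b => Ψ (e a) (s b)).det = 1 := by
  let π (s : S) : Dual K Ψ.range := LinearMap.proj s ∘ₗ Ψ.range.subtype
  have hπ : span K (Set.range π) = ⊤ := by
    rw [← Subspace.dualCoannihilator_dualAnnihilator_eq (W := span K (Set.range π)),
      dualAnnihilator_eq_top_iff, eq_bot_iff]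
    intro w hw
    rw [mem_dualCoannihilator] at hw
    ext s
    exact hw (π s) (subset_span ⟨s, rfl⟩)
  obtain ⟨I, a, -, hspan, hli⟩ := exists_linearIndependent' K π
  let b₀ : Basis I K (Dual K Ψ.range) := Basis.mk hli (by rw [hspan, hπ])
  have : Finite I := Module.Finite.finite_basis b₀
  have : Fintype I := Fintype.ofFinite I
  let b := b₀.reindex (Fintype.equivFinOfCardEq
    ((finrank_eq_card_basis b₀).symm.trans Subspace.dual_finrank_eq))
  choose e he using fun i => LinearMap.mem_range.1 ((evalEquiv K Ψ.range).symm (b.dualBasis i)).2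
  refine ⟨e, fun i => a ((Fintype.equivFinOfCardEq
    ((finrank_eq_card_basis b₀).symm.trans Subspace.dual_finrank_eq)).symm i), ?_⟩
  rw [← Matrix.det_one (n := Fin (finrank K Ψ.range))]
  congr 1
  ext i j
  have h : b j ((evalEquiv K Ψ.range).symm (b.dualBasis i)) = if i = j then 1 else 0 := by
    rw [apply_evalEquiv_symm_apply, Basis.dualBasis_apply_self]
    simp only [eq_comm]
  rw [Matrix.of_apply, he, Matrix.one_apply, ← h, Basis.reindex_apply, Basis.mk_apply]
  rfl

variable {K κ : Type*} [Field K] {m : ℕ}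

theorem sum_apply_eq_zero_of_sum_ιMulti {V : Type*} [AddCommGroup V] [Module K V] {q v : Fin m → V}
    (h : ∑ j, exteriorPower.ιMulti K m (Function.update q j (v j)) = 0)
    {φ : Fin m → Dual K V} (hφ : ∀ i j, φ j (q i) = if i = j then 1 else 0) :
    ∑ j, φ j (v j) = 0 := by
  have := congrArg (exteriorPower.pairingDual K V m (exteriorPower.ιMulti K m φ)) h
  rw [map_sum, map_zero] at this
  rw [← this]
  refine Finset.sum_congr rfl fun j _ => ?_
  rw [exteriorPower.pairingDual_ιMulti_ιMulti]
  have hM : (Matrix.of fun i l => φ l (Function.update q j (v j) i)) =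
      Matrix.updateRow (1 : Matrix (Fin m) (Fin m) K) j fun l => φ l (v j) := by
    ext i l
    by_cases hi : i = j
    · subst hi; simp
    · simp [hi, hφ, Matrix.one_apply]
  rw [hM, ← Matrix.cramer_transpose_apply, Matrix.transpose_one, Matrix.cramer_one]
  rfl

theorem LinearIndependent.exists_matrix_of_sum_ιMulti {V : Type*} [AddCommGroup V] [Module K V]
    {q v : Fin m → V} (hq : LinearIndependent K q)
    (h : ∑ j, exteriorPower.ιMulti K m (Function.update q j (v j)) = 0) :
    ∃ M : Matrix (Fin m) (Fin m) K, M.trace = 0 ∧ ∀ j, v j = ∑ l, M j l • q l := by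
  obtain ⟨g, hg⟩ := LinearMap.exists_leftInverse_of_injective
    (Fintype.linearCombination K q) (LinearMap.ker_eq_bot.2 hq.fintypeLinearCombination_injective)
  let φ (j : Fin m) : Dual K V := LinearMap.proj j ∘ₗ g
  have hφ : ∀ i j, φ j (q i) = if i = j then 1 else 0 := fun i j => by
    have := congrFun (LinearMap.congr_fun hg (Pi.single i 1)) j
    simp only [LinearMap.comp_apply, Fintype.linearCombination_apply_single, one_smul,
      LinearMap.id_apply, Pi.single_apply] at this
    simpa [φ, eq_comm] using this
  have h0 := sum_apply_eq_zero_of_sum_ιMulti h hφ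
  have hv : ∀ l, v l ∈ span K (Set.range q) := by
    intro l
    by_contra hl
    obtain ⟨θ, hθ, hker⟩ := Submodule.exists_le_ker_of_notMem hl
    have hφ' : ∀ i j, (φ + Pi.single l θ : Fin m → Dual K V) j (q i) = if i = j then 1 else 0 := fun i j => by
      have : θ (q i) = 0 := LinearMap.mem_ker.1 (hker (subset_span ⟨i, rfl⟩))
      by_cases hj : j = l
      · subst hj; simp [hφ, this]
      · simp [hj, hφ]
    have h1 := sum_apply_eq_zero_of_sum_ιMulti h hφ'
    simp only [Pi.add_apply, LinearMap.add_apply, Finset.sum_add_distrib, h0, zero_add] at h1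
    rw [Finset.sum_eq_single l (fun j _ hj => by simp [hj]) (by simp)] at h1
    exact hθ (by simpa using h1)
  choose M hM using fun j => (mem_span_range_iff_exists_fun K).1 (hv j)
  refine ⟨M, ?_, fun j => (hM j).symm⟩
  rw [← h0]
  refine Finset.sum_congr rfl fun j _ => ?_
  rw [← hM j, map_sum]
  simp only [map_smul, hφ, smul_eq_mul, mul_ite, mul_one, mul_zero, Finset.sum_ite_eq',
    Finset.mem_univ, if_true]
  rfl

end Minors

section RankEstimate

open Module

variable {K V ι : Type*} [Field K] [AddCommGroup V] [Module K V] [Fintype ι] {m : ℕ}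

/-- The first order variation of the combinations `∑ i, A j i • p i` when `p i` moves along
`T i` and `A j i` moves freely. -/
def combVariation (T : ι → Submodule K V) (p : ι → V) (A : Fin m → ι → K) :
    ((∀ i, T i) × (Fin m → ι → K)) →ₗ[K] Fin m → V :=
  LinearMap.pi fun j => weightedSum T (A j) ∘ₗ LinearMap.fst K _ _ +
    Fintype.linearCombination K p ∘ₗ LinearMap.proj j ∘ₗ LinearMap.snd K _ _

theorem combVariation_apply (T : ι → Submodule K V) (p : ι → V) (A : Fin m → ι → K)
    (t : ∀ i, T i) (μ : Fin m → ι → K) (j : Fin m) :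
    combVariation T p A (t, μ) j = ∑ i, A j i • (t i : V) + ∑ i, μ j i • p i := by
  simp [combVariation, weightedSum_apply, Fintype.linearCombination_apply]

variable {T : ι → Submodule K V} {p : ι → V}

theorem LinearIndependent.sum_smul (hp : LinearIndependent K p) {A : Fin m → ι → K}
    (hA : LinearIndependent K A) : LinearIndependent K fun j => ∑ i, A j i • p i :=
  hA.map' (Fintype.linearCombination K p)
    (LinearMap.ker_eq_bot.2 hp.fintypeLinearCombination_injective)

/-- The infinitesimal automorphisms: rescalings of the points and traceless changes of the
combinations. -/
def trivialVariation (h : ∀ i, p i ∈ T i) (A : Fin m → ι → K) :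
    ((ι → K) × (Matrix.traceLinearMap (Fin m) K K).ker) →ₗ[K]
      (∀ i, T i) × (Fin m → ι → K) :=
  LinearMap.prod
    (LinearMap.pi fun i => LinearMap.toSpanSingleton K (T i) ⟨p i, h i⟩ ∘ₗ LinearMap.proj i ∘ₗ
      LinearMap.fst K _ _)
    (LinearMap.pi fun j => LinearMap.pi fun i =>
      (∑ l, A l i • LinearMap.proj l ∘ₗ LinearMap.proj j ∘ₗ
        (Matrix.traceLinearMap (Fin m) K K).ker.subtype ∘ₗ LinearMap.snd K _ _) -
      A j i • LinearMap.proj i ∘ₗ LinearMap.fst K _ _)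

variable [FiniteDimensional K V]

theorem InGeneralPosition.finrank_ker_le (h : InGeneralPosition T p) {A : Fin (m + 1) → ι → K}
    (hA : LinearIndependent K A) :
    finrank K (((exteriorPower.ιMulti K (m + 1)).toMultilinearMap.linearDeriv
      fun j => ∑ i, A j i • p i) ∘ₗ combVariation T p A).ker + 1 ≤
    finrank K (syz (fun i => (T i).map (span K (Set.range p)).mkQ) (span K (Set.range A))) +
      (Fintype.card ι + (m + 1) ^ 2) := by
  set P := span K (Set.range p)
  set Ψ := (((exteriorPower.ιMulti K (m + 1)).toMultilinearMap.linearDeriv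
      fun j => ∑ i, A j i • p i) ∘ₗ combVariation T p A)
  let τ (i : ι) := (T i).map P.mkQ
  let red : ((∀ i, T i) × (Fin (m + 1) → ι → K)) →ₗ[K] ∀ i, τ i :=
    LinearMap.pi fun i => P.mkQ.submoduleMap (T i) ∘ₗ LinearMap.proj i ∘ₗ LinearMap.fst K _ _
  have hred (t : ∀ i, T i) (μ i) : (red (t, μ) i : V ⧸ P) = P.mkQ (t i) := rfl
  have hker : ∀ t μ, (t, μ) ∈ Ψ.ker → ∃ M : Matrix (Fin (m + 1)) (Fin (m + 1)) K, M.trace = 0 ∧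
      ∀ j, ∑ i, A j i • (t i : V) + ∑ i, μ j i • p i = ∑ l, M j l • ∑ i, A l i • p i := by
    intro t μ ht
    obtain ⟨M, hM, hM'⟩ := (h.linearIndependent.sum_smul hA).exists_matrix_of_sum_ιMulti
      (v := combVariation T p A (t, μ)) (by
        simpa [Ψ, MultilinearMap.linearDeriv_apply] using ht)
    exact ⟨M, hM, fun j => by rw [← hM', combVariation_apply]⟩
  have hP (c : ι → K) : ∑ i, c i • p i ∈ P :=
    sum_mem fun i _ => smul_mem _ _ (subset_span ⟨i, rfl⟩)
  have h1 := (red.domRestrict Ψ.ker).finrank_range_add_finrank_ker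
  have h2 : finrank K (red.domRestrict Ψ.ker).range ≤
      finrank K (syz τ (span K (Set.range A))) := by
    refine finrank_mono ?_
    rintro _ ⟨⟨⟨t, μ⟩, ht⟩, rfl⟩
    obtain ⟨M, -, hM⟩ := hker t μ ht
    refine mem_syz.2 fun w hw => ?_
    rw [← weightedSum_apply]
    induction hw using span_induction with
    | mem w hw =>
      obtain ⟨j, rfl⟩ := hw
      have hj : ∑ i, A j i • (t i : V) ∈ P := by
        rw [eq_sub_of_add_eq (hM j)]
        exact sub_mem (sum_mem fun l _ => smul_mem _ _ (hP _)) (hP _)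
      rw [weightedSum_apply]
      simpa only [LinearMap.domRestrict_apply, hred, ← map_smul, ← map_sum] using!
        (Submodule.Quotient.mk_eq_zero P).2 hj
    | zero => simp [weightedSum_apply]
    | add w w' _ _ hw hw' =>
      simp only [weightedSum_apply, Pi.add_apply, add_smul, Finset.sum_add_distrib] at *
      rw [hw, hw', add_zero]
    | smul a w _ hw =>
      simp only [weightedSum_apply, Pi.smul_apply, smul_assoc, ← Finset.smul_sum] at *
      rw [hw, smul_zero]
  have h3 : finrank K (red.domRestrict Ψ.ker).ker ≤
      finrank K (trivialVariation h.mem A).range := by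
    rw [← finrank_map_subtype_eq]
    refine finrank_mono ?_
    rintro _ ⟨⟨⟨t, μ⟩, ht⟩, hr, rfl⟩
    have hc : ∀ i, ∃ c : K, c • p i = t i := fun i => by
      have : P.mkQ (t i) = 0 := by
        rw [← hred t μ, show red (t, μ) = 0 from hr]
        rfl
      rw [← mem_span_singleton, ← h.inf_span_eq i]
      exact ⟨(t i).2, (Submodule.Quotient.mk_eq_zero P).1 this⟩
    choose c hc using hc
    obtain ⟨M, hM, hM'⟩ := hker t μ ht
    refine ⟨(c, ⟨M, LinearMap.mem_ker.2 hM⟩), Prod.ext (funext fun i => Subtype.ext (hc i)) ?_⟩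
    ext j i
    have := hM' j
    simp_rw [← hc, smul_smul, Finset.smul_sum, smul_smul] at this
    rw [Finset.sum_comm, ← Finset.sum_add_distrib] at this
    simp_rw [← Finset.sum_smul, ← add_smul] at this
    have := congrFun (h.linearIndependent.fintypeLinearCombination_injective this) i
    change _ = μ j i
    rw [show μ j i = ∑ l, M j l * A l i - A j i * c i from eq_sub_of_add_eq' this]
    simp only [trivialVariation, mul_comm (M j _)]
    simp
    rfl
  have h4 := (trivialVariation h.mem A).finrank_range_le
  have h5 := Module.Dual.finrank_ker_add_one_of_ne_zero
    (f := Matrix.traceLinearMap (Fin (m + 1)) K K) (fun h0 => by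
      simpa using LinearMap.congr_fun h0 (Matrix.single 0 0 1))
  rw [finrank_prod, finrank_fintype_fun_eq_card] at h4
  rw [finrank_matrix] at h5
  simp only [Fintype.card_fin, finrank_self] at h5
  nlinarith

theorem InGeneralPosition.le_finrank_range (h : InGeneralPosition T p)
    {A : Fin (m + 1) → ι → K} (hA : LinearIndependent K A) :
    ∑ i, finrank K ((T i).map (span K (Set.range p)).mkQ) + (m + 1) * Fintype.card ι + 1 ≤
    finrank K (((exteriorPower.ιMulti K (m + 1)).toMultilinearMap.linearDeriv
      fun j => ∑ i, A j i • p i) ∘ₗ combVariation T p A).range +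
    finrank K (syz (fun i => (T i).map (span K (Set.range p)).mkQ) (span K (Set.range A))) +
      (m + 1) ^ 2 := by
  have h1 := LinearMap.finrank_range_add_finrank_ker
    (((exteriorPower.ιMulti K (m + 1)).toMultilinearMap.linearDeriv
      fun j => ∑ i, A j i • p i) ∘ₗ combVariation T p A)
  have h2 := h.finrank_ker_le hA
  simp only [finrank_prod, finrank_pi_fintype, finrank_self, ← h.finrank_map_mkQ,
    Finset.sum_add_distrib, Finset.sum_const, Finset.card_univ, Fintype.card_fin, smul_eq_mul,
    mul_one] at h1
  omega

end RankEstimate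

section VariationOfMinors

open MvPolynomial Function

section Leibniz

variable {R S : Type*} [CommRing R] [CommRing S] {ε : R →+* S} {δ : R →+ S}

theorem AddMonoidHom.map_prod_of_leibniz (hδ : ∀ a b, δ (a * b) = ε a * δ b + δ a * ε b)
    {α : Type*} [DecidableEq α] (s : Finset α) (f : α → R) :
    δ (∏ i ∈ s, f i) = ∑ j ∈ s, ∏ i ∈ s, update (fun i => ε (f i)) j (δ (f j)) i := by
  induction s using Finset.induction_on with
  | empty => simpa using hδ 1 1
  | insert a s ha ih =>
    rw [Finset.prod_insert ha, hδ, ih, Finset.sum_insert ha, Finset.prod_insert ha, update_self,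
      map_prod, add_comm, Finset.mul_sum]
    congr 1
    · congr 1
      exact Finset.prod_congr rfl fun i hi => by
        rw [update_of_ne (ne_of_mem_of_not_mem hi ha)]
    · refine Finset.sum_congr rfl fun j hj => ?_
      rw [Finset.prod_insert ha, update_of_ne (ne_of_mem_of_not_mem hj ha).symm]

theorem AddMonoidHom.map_det_of_leibniz (hδ : ∀ a b, δ (a * b) = ε a * δ b + δ a * ε b)
    {α : Type*} [Fintype α] [DecidableEq α] (N : Matrix α α R) :
    δ N.det = ∑ j, (Matrix.updateRow (N.map ε) j fun l => δ (N j l)).det := by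
  simp_rw [← Matrix.det_transpose N, ← Matrix.det_transpose (Matrix.updateRow _ _ _),
    Matrix.det_apply, Units.smul_def, map_sum, map_zsmul, δ.map_prod_of_leibniz hδ,
    Finset.smul_sum]
  rw [Finset.sum_comm]
  refine Finset.sum_congr rfl fun j _ => Finset.sum_congr rfl fun σ _ => ?_
  congr 1
  refine Finset.prod_congr rfl fun i _ => ?_
  by_cases h : i = j
  · subst h; simp
  · simp [h]

end Leibniz

theorem MvPolynomial.eq_zero_of_forall_eval_complex {K M : Type*} [Field K] [Algebra ℂ K]
    {G : MvPolynomial M K} (h : ∀ z : M → ℂ, eval (fun a => algebraMap ℂ K (z a)) G = 0) :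
    G = 0 := by
  refine MvPolynomial.funext_set (fun _ => Set.range (algebraMap ℂ K))
    (fun _ => Set.infinite_range_of_injective (algebraMap ℂ K).injective) (fun x hx => ?_)
  choose z hz using fun a => hx a (Set.mem_univ a)
  obtain rfl : (fun a => algebraMap ℂ K (z a)) = x := _root_.funext hz
  rw [h, map_zero]

variable {ι κ K M : Type} [Field K] [Algebra ℂ K] {X : Set (κ → ℂ)} {p : ι → κ → K}

/-- A point of a power of `K ^ κ` together with additional free parameters. -/
def freeExtension (M : Type) (p : ι → κ → K) : (ι × κ) ⊕ M → MvPolynomial M K :=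
  Sum.elim (fun s => C (uncurry p s)) MvPolynomial.X

/-- Replace the additional parameters by numbers. -/
def fixParams (z : M → ℂ) : MvPolynomial ((ι × κ) ⊕ M) ℂ →ₐ[ℂ] MvPolynomial (ι × κ) ℂ :=
  aeval (Sum.elim MvPolynomial.X fun a => C (z a))

theorem aeval_fixParams {R : Type*} [CommRing R] [Algebra ℂ R] (z : M → ℂ) (x : ι × κ → R)
    (F : MvPolynomial ((ι × κ) ⊕ M) ℂ) :
    aeval x (fixParams z F) = aeval (Sum.elim x fun a => algebraMap ℂ R (z a)) F := by
  rw [fixParams, comp_aeval_apply]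
  congr 2
  ext (s | a) <;> simp

theorem eval_aeval_freeExtension (x : M → K) (F : MvPolynomial ((ι × κ) ⊕ M) ℂ) :
    eval x (aeval (freeExtension M p) F) = aeval (Sum.elim (uncurry p) x) F := by
  rw [← coe_aeval_eq_eval, RingHom.coe_coe, ← AlgHom.restrictScalars_apply ℂ,
    comp_aeval_apply]
  congr 2
  ext (s | a) <;> simp [freeExtension]

theorem pderiv_fixParams [Fintype ι] [Fintype κ] [Fintype M] (z : M → ℂ) (s : ι × κ)
    (F : MvPolynomial ((ι × κ) ⊕ M) ℂ) :
    pderiv s (fixParams z F) = fixParams z (pderiv (Sum.inl s) F) := by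
  classical
  rw [fixParams, Derivation.apply_mvPolynomial_aeval, Finset.sum_eq_single (Sum.inl s)]
  · simp
  · rintro (t | a) - h
    · have : t ≠ s := fun h' => h (by rw [h'])
      simp [pderiv_X, this]
    · simp
  · simp

theorem IsGeneric.aeval_freeExtension_eq_zero (hp : IsGeneric X p)
    {F : MvPolynomial ((ι × κ) ⊕ M) ℂ} : aeval (freeExtension M p) F = 0 ↔
      ∀ (P : ι → κ → ℂ) (z : M → ℂ), (∀ i, P i ∈ X) → aeval (Sum.elim (uncurry P) z) F = 0 := by
  have key (z : M → ℂ) : aeval (Sum.elim (uncurry p) fun a => algebraMap ℂ K (z a)) F = 0 ↔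
      ∀ P : ι → κ → ℂ, (∀ i, P i ∈ X) → aeval (Sum.elim (uncurry P) z) F = 0 := by
    rw [← aeval_fixParams, hp]
    simp only [aeval_fixParams, Algebra.algebraMap_self, RingHom.id_apply]
  refine ⟨fun h P z hP => (key z).1 ?_ P hP, fun h => eq_zero_of_forall_eval_complex fun z => ?_⟩
  · rw [← eval_aeval_freeExtension, h, map_zero]
  · rw [eval_aeval_freeExtension, (key z).2 fun P hP => h P z hP]

theorem IsGeneric.sum_pderiv_freeExtension [Fintype ι] [Fintype κ] [Fintype M]
    (hp : IsGeneric X p) {v : ι → κ → K} (hv : ∀ i, v i ∈ tan X (p i)) (μ : M → K)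
    {F : MvPolynomial ((ι × κ) ⊕ M) ℂ} (hF : aeval (freeExtension M p) F = 0) :
    ∑ s, aeval (freeExtension M p) (pderiv s F) * C (Sum.elim (uncurry v) μ s) = 0 := by
  classical
  rw [Fintype.sum_sum_type, Fintype.sum_prod_type]
  have hM (a : M) : aeval (freeExtension M p) (pderiv (Sum.inr a) F) = 0 := by
    have h := Derivation.apply_mvPolynomial_aeval ((pderiv (R := K) a).restrictScalars ℂ)
      (freeExtension M p) F
    rw [hF, map_zero, Finset.sum_eq_single (Sum.inr a)] at h
    · simpa [freeExtension] using h.symm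
    · rintro (t | b) - hb
      · simp [freeExtension]
      · have : b ≠ a := fun h' => hb (by rw [h'])
        simp [freeExtension, pderiv_X, this]
    · simp
  have hι (i : ι) : ∑ c, aeval (freeExtension M p) (pderiv (Sum.inl (i, c)) F) * C (v i c) = 0 := by
    refine eq_zero_of_forall_eval_complex fun z => ?_
    have h : aeval (uncurry p) (fixParams z F) = 0 := by
      rw [aeval_fixParams, ← eval_aeval_freeExtension, hF, map_zero]
    rw [← hp.sum_pderiv_eq_zero (hv i) h]
    simp only [map_sum, map_mul, eval_C, eval_aeval_freeExtension, pderiv_fixParams,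
      aeval_fixParams]
  simp [hM, hι]

end VariationOfMinors

section PlueckerCoordinates

open MvPolynomial Function Module

/-- The Plücker coordinates of the span of the rows of a matrix. -/
def minors {κ R : Type*} [LinearOrder κ] [CommRing R] {m : ℕ} (q : Fin m → κ → R)
    (s : Set.powersetCard κ m) : R :=
  (Matrix.of fun j l => q j (Set.powersetCard.ofFinEmbEquiv.symm s l)).det

/-- The combinations of a family of vectors with given coefficients. -/
def combs {ι κ R : Type*} [Fintype ι] [CommRing R] {m : ℕ} (z : (ι × κ) ⊕ (Fin m × ι) → R)
    (j : Fin m) (c : κ) : R :=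
  ∑ i, z (Sum.inr (j, i)) * z (Sum.inl (i, c))

variable {ι κ : Type} [Fintype ι] [LinearOrder κ] {m : ℕ}

/-- Plücker coordinates of the span of universal combinations of universal vectors. -/
def minorPoly (ι : Type) [Fintype ι] (s : Set.powersetCard κ m) :
    MvPolynomial ((ι × κ) ⊕ (Fin m × ι)) ℂ :=
  minors (combs MvPolynomial.X) s

theorem map_minors {R S : Type*} [CommRing R] [CommRing S] (φ : R →+* S) (q : Fin m → κ → R)
    (s : Set.powersetCard κ m) : φ (minors q s) = minors (fun j c => φ (q j c)) s := by
  rw [minors, RingHom.map_det]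
  rfl

theorem aeval_minorPoly {R : Type*} [CommRing R] [Algebra ℂ R] (z : (ι × κ) ⊕ (Fin m × ι) → R)
    (s : Set.powersetCard κ m) : aeval z (minorPoly ι s) = minors (combs z) s := by
  rw [minorPoly, ← RingHom.coe_coe, map_minors]
  congr 1
  ext j c
  simp [combs]

variable {K : Type} [Field K] [Algebra ℂ K] {X : Set (κ → ℂ)} {p : ι → κ → K}

/-- The Plücker points of the spans of combinations of points of `X`. -/
def pluckerPre (X : Set (κ → ℂ)) (ι : Type) [Fintype ι] (m : ℕ) :
    Set (Set.powersetCard κ m → ℂ) :=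
  {y | ∃ (P : ι → κ → ℂ) (z : Fin m × ι → ℂ), (∀ i, P i ∈ X) ∧
    y = minors (combs (Sum.elim (uncurry P) z))}

theorem IsGeneric.mem_vanishingIdeal_pluckerPre (hp : IsGeneric X p)
    {F : MvPolynomial (Set.powersetCard κ m) ℂ} : F ∈ vanishingIdeal ℂ (pluckerPre X ι m) ↔
      aeval (freeExtension (Fin m × ι) p) (aeval (minorPoly ι) F) = 0 := by
  rw [hp.aeval_freeExtension_eq_zero, mem_vanishingIdeal_iff]
  have (x : (ι × κ) ⊕ (Fin m × ι) → ℂ) :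
      aeval x (aeval (minorPoly ι) F) = aeval (minors (combs x)) F := by
    rw [comp_aeval_apply]
    simp only [aeval_minorPoly]
  simp only [this]
  constructor
  · exact fun h P z hP => h _ ⟨P, z, hP, rfl⟩
  · rintro h _ ⟨P, z, hP, rfl⟩
    exact h P z hP

theorem IsGeneric.isPrime_vanishingIdeal_pluckerPre (hp : IsGeneric X p) :
    (vanishingIdeal ℂ (pluckerPre X ι m)).IsPrime := by
  have : vanishingIdeal ℂ (pluckerPre X ι m) = RingHom.ker
      ((aeval (freeExtension (Fin m × ι) p)).comp (aeval (R := ℂ) (minorPoly (κ := κ) ι))) := by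
    ext F
    rw [hp.mem_vanishingIdeal_pluckerPre, RingHom.mem_ker]
    rfl
  rw [this]
  exact RingHom.ker_isPrime _

variable [Fintype κ]

theorem basis_repr_ιMulti {K : Type*} [Field K] (q : Fin m → κ → K) (s : Set.powersetCard κ m) :
    ((Pi.basisFun K κ).exteriorPower m).repr (exteriorPower.ιMulti K m q) s = minors q s := by
  rw [exteriorPower.basis_repr_apply, exteriorPower.ιMultiDual_apply_ιMulti]
  simp [minors]

theorem adim_zcl_pluckerPre_le (X : Set (κ → ℂ)) (h k : ℕ) :
    adim (zcl (pluckerPre X (Fin (k + 1)) (h + 1))) ≤ adim (GhkCone X h k) := by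
  let B := (Pi.basisFun ℂ κ).exteriorPower (h + 1)
  let L : (Set.powersetCard κ (h + 1) → ℂ) →ₗ[ℂ] ExteriorAlgebra ℂ (κ → ℂ) :=
    (⋀[ℂ]^(h + 1) (κ → ℂ)).subtype ∘ₗ B.equivFun.symm.toLinearMap
  obtain ⟨R, hR⟩ := LinearMap.exists_leftInverse_of_injective L (LinearMap.ker_eq_bot.2
    ((Submodule.subtype_injective _).comp B.equivFun.symm.injective))
  refine (adim_mono (zcl_subset (isAlgSet_zcl _) ?_)).trans (adim_zcl_preimage_le hR)
  refine Set.Subset.trans ?_ (subset_zcl _)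
  rintro _ ⟨P, z, hP, rfl⟩
  refine ⟨P, combs (Sum.elim (uncurry P) z), hP, fun j => ?_, ?_⟩
  · refine (mem_span_range_iff_exists_fun ℂ).2 ⟨fun i => z (j, i), ?_⟩
    ext c
    simp [combs]
  · have : B.equivFun.symm (minors (combs (Sum.elim (uncurry P) z))) =
        exteriorPower.ιMulti ℂ (h + 1) (combs (Sum.elim (uncurry P) z)) := by
      rw [LinearEquiv.symm_apply_eq]
      ext s
      rw [Basis.equivFun_apply, basis_repr_ιMulti]
    simp only [L, LinearMap.comp_apply, LinearEquiv.coe_coe, this]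
    rfl

theorem sum_aeval_pderiv_minorPoly (A : Fin m → ι → K) (v : ι → κ → K) (μ : Fin m → ι → K)
    (s : Set.powersetCard κ m) :
    ∑ x, aeval (Sum.elim (uncurry p) (uncurry A)) (pderiv x (minorPoly ι s)) *
      Sum.elim (uncurry v) (uncurry μ) x =
    ∑ j, minors (update (fun j => ∑ i, A j i • p i) j
      (∑ i, A j i • v i + ∑ i, μ j i • p i)) s := by
  classical
  let ε := aeval (R := ℂ) (Sum.elim (uncurry p) (uncurry A))
  let δ : MvPolynomial ((ι × κ) ⊕ (Fin m × ι)) ℂ →+ K :=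
    ∑ x, (AddMonoidHom.mulRight (Sum.elim (uncurry v) (uncurry μ) x)).comp
      ((ε : _ →+ K).comp (pderiv (R := ℂ) x).toLinearMap.toAddMonoidHom)
  have hδ' (F) : δ F = ∑ x, ε (pderiv x F) * Sum.elim (uncurry v) (uncurry μ) x := by
    simp only [δ, AddMonoidHom.finsetSum_apply]
    rfl
  have hδ (F G) : δ (F * G) = (ε : _ →+* K) F * δ G + δ F * (ε : _ →+* K) G := by
    simp only [hδ', Derivation.leibniz, smul_eq_mul, map_add, map_mul, Finset.mul_sum,
      Finset.sum_mul, ← Finset.sum_add_distrib, RingHom.coe_coe]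
    exact Finset.sum_congr rfl fun x _ => by ring
  have hX (x) : δ (MvPolynomial.X x) = Sum.elim (uncurry v) (uncurry μ) x := by
    rw [hδ', Finset.sum_eq_single x]
    · simp
    · intro y _ hy
      simp [pderiv_X, hy.symm]
    · simp
  rw [← hδ', minorPoly, minors, δ.map_det_of_leibniz hδ]
  refine Finset.sum_congr rfl fun j _ => ?_
  rw [minors]
  congr 1
  ext a l
  by_cases ha : a = j
  · subst ha
    simp [combs, hδ, hX, ε, Finset.sum_add_distrib]
  · simp [ha, combs, ε]

theorem IsGeneric.finrank_range_le_adim {k h : ℕ} {p : Fin (k + 1) → κ → K} (hp : IsGeneric X p)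
    (A : Fin (h + 1) → Fin (k + 1) → K) :
    (finrank K (((exteriorPower.ιMulti K (h + 1)).toMultilinearMap.linearDeriv
      fun j => ∑ i, A j i • p i) ∘ₗ combVariation (fun i => tan X (p i)) p A).range : ℕ∞) ≤
    adim (GhkCone X h k) := by
  classical
  let B := (Pi.basisFun K κ).exteriorPower (h + 1)
  set Ψ := ((exteriorPower.ιMulti K (h + 1)).toMultilinearMap.linearDeriv
      fun j => ∑ i, A j i • p i) ∘ₗ combVariation (fun i => tan X (p i)) p A
  have hd : finrank K (B.equivFun.toLinearMap ∘ₗ Ψ).range = finrank K Ψ.range := by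
    rw [LinearMap.range_comp]
    exact B.equivFun.finrank_map_eq _
  obtain ⟨e, s, hes⟩ := LinearMap.exists_det_eq_one (B.equivFun.toLinearMap ∘ₗ Ψ)
  rw [← hd]
  refine le_trans ?_ (adim_zcl_pluckerPre_le X h k)
  refine le_adim hp.isPrime_vanishingIdeal_pluckerPre (fun b => MvPolynomial.X (s b))
    fun G hG => ?_
  have hind := algebraicIndependent_of_det_ne_zero (freeExtension (Fin (h + 1) × Fin (k + 1)) p)
    (fun b => minorPoly (Fin (k + 1)) (s b))
    (fun a x => C (Sum.elim (uncurry fun i => ((e a).1 i : κ → K)) (uncurry (e a).2) x))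
    (fun a F hF => hp.sum_pderiv_freeExtension (fun i => ((e a).1 i).2) _ hF) fun h0 => by
      have := congrArg (MvPolynomial.eval (uncurry A)) h0
      rw [RingHom.map_det, map_zero] at this
      refine one_ne_zero (hes.symm.trans (Eq.trans ?_ this))
      congr 1
      ext a b
      simp only [RingHom.mapMatrix_apply, Matrix.map_apply, Matrix.of_apply, map_sum, map_mul,
        eval_C, eval_aeval_freeExtension, sum_aeval_pderiv_minorPoly]
      simp only [LinearMap.comp_apply, LinearEquiv.coe_coe, Basis.equivFun_apply, Ψ,
        MultilinearMap.linearDeriv_apply, map_sum, Finset.sum_apply]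
      refine Finset.sum_congr rfl fun j _ => ?_
      rw [← combVariation_apply, ← basis_repr_ιMulti]
      rfl
  refine (injective_iff_map_eq_zero _).1 hind G ?_
  rw [hp.mem_vanishingIdeal_pluckerPre, comp_aeval_apply, comp_aeval_apply] at hG
  simpa using hG

theorem IsGeneric.le_adim_ghkCone {k h : ℕ} {p : Fin (k + 1) → κ → K} (hp : IsGeneric X p)
    (hpos : InGeneralPosition (fun i => tan X (p i)) p) {U : Submodule K (Fin (k + 1) → K)}
    (hU : finrank K U = h + 1) :
    ((∑ i, finrank K ((tan X (p i)).map (span K (Set.range p)).mkQ) + (h + 1) * (k + 1) + 1 : ℕ) :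
      ℕ∞) ≤ adim (GhkCone X h k) + (finrank K
        (syz (fun i => (tan X (p i)).map (span K (Set.range p)).mkQ) U) + (h + 1) ^ 2 : ℕ) := by
  let b := (finBasis K U).reindex (finCongr hU)
  let A (j : Fin (h + 1)) : Fin (k + 1) → K := b j
  have hA : LinearIndependent K A := b.linearIndependent.map' U.subtype (ker_subtype U)
  have hAU : span K (Set.range A) = U := by
    have : Set.range A = U.subtype '' Set.range b := by
      rw [← Set.range_comp]
      rfl
    rw [this, span_image, b.span_eq, map_subtype_top]
  have h1 := hpos.le_finrank_range hA
  rw [hAU, Fintype.card_fin, add_assoc (finrank K _)] at h1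
  refine le_trans (Nat.cast_le.2 h1) ?_
  rw [Nat.cast_add]
  gcongr
  exact hp.finrank_range_le_adim A

end PlueckerCoordinates

/-- If `X` is not a cone, `S_{k-1}(X) ≠ P^r`, and
`dim G_{h,k}(X) = (k-h)(h+1) + n(k+1) - x` with `x > 0`, then
`dim S_k(X) ≤ n(k+1) + k - x - 2h`. -/
theorem dim_Sec_le_of_degenerate_Ghk (r n h k x : ℕ) (hh : 0 < h) (hhk : h < k)
    (hx : 0 < x) (X : Set (Fin (r + 1) → ℂ)) (hX : IsProjVar X) (hnd : Nondeg X)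
    (hdim : pdim X = (n : ℕ∞)) (hnc : ¬ IsConeVar X)
    (hsec : Sec X (k - 1) ≠ Set.univ)
    (hG : pdim (GhkCone X h k) + (x : ℕ∞) =
      (((k - h) * (h + 1) + n * (k + 1) : ℕ) : ℕ∞)) :
    pdim (Sec X k) + (x : ℕ∞) + ((2 * h : ℕ) : ℕ∞) ≤ ((n * (k + 1) + k : ℕ) : ℕ∞) := by
  obtain ⟨k, rfl⟩ : ∃ k', k = k' + 1 := ⟨k - 1, by omega⟩
  rw [Nat.add_sub_cancel] at hsec
  obtain ⟨K, _, _, _, p, hp⟩ := hX.2.2.1.exists_isGeneric (Fin (k + 1 + 1))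
  have hpos : InGeneralPosition (fun i => tan X (p i)) p :=
    ⟨hp.mem_tan_self hX.2.1, hp.notMem_iSup_tan hnd hsec⟩
  let τ := fun i => (tan X (p i)).map (span K (Set.range p)).mkQ
  have hcard : Fintype.card (Fin (k + 1 + 1)) = k + 2 := Fintype.card_fin _
  have hN : n * (k + 2) ≤ ∑ i, Module.finrank K (τ i) := by
    have := Finset.card_nsmul_le_sum Finset.univ (fun i => Module.finrank K (τ i)) n fun i _ => by
      have := hp.natCast_le_finrank_tan hX hdim i
      rw [← hpos.finrank_map_mkQ i] at this
      exact Nat.le_of_succ_le_succ this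
    rwa [Finset.card_univ, hcard, smul_eq_mul, mul_comm] at this
  have hsyz (U : Submodule K (Fin (k + 1 + 1) → K)) :
      Module.finrank K (syz τ U) ≤ ∑ i, Module.finrank K (τ i) :=
    (finrank_le _).trans_eq (Module.finrank_pi_fintype K)
  have hg : adim (GhkCone X h (k + 1)) ≠ ⊤ := fun htop => by
    rw [pdim, htop] at hG
    exact ENat.natCast_ne_top _ hG.symm
  obtain ⟨g, hg⟩ := ENat.ne_top_iff_exists.1 hg
  rw [pdim, ← hg] at hG
  have hG' : g - 1 + x = (k + 1 - h) * (h + 1) + n * (k + 2) := by exact_mod_cast hG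
  have hD : (h + 1) * (k + 2) = (k + 1 - h) * (h + 1) + (h + 1) ^ 2 := by
    obtain ⟨d, rfl⟩ := Nat.exists_eq_add_of_le (Nat.lt_succ_iff.1 hhk)
    rw [show h + d + 1 - h = d + 1 by omega]
    ring
  have hlow (U : Submodule K (Fin (k + 1 + 1) → K)) (hU : Module.finrank K U = h + 1) :
      ∑ i, Module.finrank K (τ i) + (h + 1) * (k + 2) + 1 ≤
        g + (Module.finrank K (syz τ U) + (h + 1) ^ 2) := by
    have := hp.le_adim_ghkCone hpos hU
    rw [← hg] at this
    exact_mod_cast this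
  obtain ⟨U, hU, hle⟩ := exists_finrank_syz_add_le (τ := τ) (h := h) (by omega)
    (fun U hU h0 => by
      have := hlow U hU
      rw [h0, finrank_bot] at this
      omega)
    fun J i j₁ j₂ u hi hj₁ hj₂ hne hu0 hu hJi =>
      hnc (hp.isConeVar hX hpos hi hj₁ hj₂ hne hu0 hu hJi)
  have hsec_le := hp.adim_sec_le hX.2.1
  have hsum : Module.finrank K ↥(⨆ i, tan X (p i)) + Module.finrank K (syz τ (span K {1})) =
      k + 2 + ∑ i, Module.finrank K (τ i) :=
    hpos.finrank_iSup_add.trans (by rw [hcard])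
  obtain ⟨a, ha⟩ := ENat.ne_top_iff_exists.1 (ne_top_of_le_ne_top (ENat.natCast_ne_top _) hsec_le)
  have hlowU := hlow U hU
  have hsyzU := hsyz U
  have hsyz1 := hsyz (span K {1})
  rw [← ha] at hsec_le
  rw [pdim, ← ha]
  rw [Nat.cast_le] at hsec_le
  have : a - 1 + x + 2 * h ≤ n * (k + 2) + (k + 1) := by omega
  exact_mod_cast this
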